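/- arXiv:2209.01147 — 7 statements merged into one kernel-verified Lean document; each statement's English description precedes it below -/
import Mathlib

section
/- Let (X,S) be a finite set system satisfying MainAssumption(a,b,γ) with 0 < γ < 1 and X ∈ S, n = |X|, m = |S|, and let ε ∈ (0,1). Then there exists a subset A ⊆ X of size at most 2·max{ (30·√(a·ln m / γ)·(1/ε))^{2/(2−γ)} , 12·√( (b/2 + 12·ln m)·ln m·log₂ n ) / ε } + 1 such that ε(A,X,S) ≤ ε, i.e., A is an ε-approximation of (X,S). -/
open Finset

/-- The number of edges of the matching `M` crossed by the range `S`
(an edge `e`, a 2-element subset, is crossed when `|S ∩ e| = 1`). -/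
def crossCount {V : Type*} [DecidableEq V] (M : Finset (Finset V)) (S : Finset V) : ℕ :=
  (M.filter fun e => e.card = 2 ∧ (S ∩ e).card = 1).card

/-- A perfect matching of `X`: a partition of `X` into disjoint edges (2-element sets),
plus at most one loop (a 1-element set, allowed when `|X|` is odd). -/
def IsPerfectMatching {V : Type*} [DecidableEq V] (X : Finset V) (M : Finset (Finset V)) : Prop :=
  (∀ e ∈ M, e.card = 2 ∨ e.card = 1) ∧
  (M : Set (Finset V)).PairwiseDisjoint id ∧
  M.biUnion id = X ∧
  (M.filter fun e => e.card = 1).card ≤ 1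

/-- MainAssumption(a,b,γ): `m ≥ n`, `m ≥ 34`, and every `Y ⊆ X` admits a perfect matching with
crossing number at most `a·|Y|^γ + b` with respect to `𝒮`. -/
def MainAssumption {V : Type*} [DecidableEq V] (X : Finset V) (𝒮 : Finset (Finset V))
    (a b γ : ℝ) : Prop :=
  X.card ≤ 𝒮.card ∧ 34 ≤ 𝒮.card ∧
  ∀ Y ⊆ X, ∃ M : Finset (Finset V), IsPerfectMatching Y M ∧
    ∀ S ∈ 𝒮, (crossCount M S : ℝ) ≤ a * (Y.card : ℝ) ^ γ + b

theorem sign_lemma {α β : Type*} [DecidableEq α] (E : Finset α) (𝒮 : Finset β) (v : α → β → ℝ)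
    (lam : ℝ) : ∀ w : β → ℝ, ∃ σ : α → ℝ, (∀ e, σ e = 1 ∨ σ e = -1) ∧
      ∑ S ∈ 𝒮, w S * Real.cosh (lam * ∑ e ∈ E, σ e * v e S) ≤
        ∑ S ∈ 𝒮, w S * ∏ e ∈ E, Real.cosh (lam * v e S) := by
  induction E using Finset.induction_on with
  | empty => intro w; exact ⟨fun _ => 1, fun _ => Or.inl rfl, by simp⟩
  | insert e E he ih =>
    intro w
    obtain ⟨σ, hσ, hle⟩ := ih (fun S => w S * Real.cosh (lam * v e S))
    have key : ∀ c : ℝ, ∀ S, ∑ e' ∈ insert e E, (Function.update σ e c) e' * v e' S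
        = c * v e S + ∑ e' ∈ E, σ e' * v e' S := by
      intro c S
      rw [Finset.sum_insert he]
      congr 1
      · simp
      · apply Finset.sum_congr rfl
        intro x hx
        have : x ≠ e := fun h => he (h ▸ hx)
        simp [Function.update_of_ne this]
    have hprod : ∑ S ∈ 𝒮, w S * ∏ e' ∈ insert e E, Real.cosh (lam * v e' S)
        = ∑ S ∈ 𝒮, w S * Real.cosh (lam * v e S) * ∏ e' ∈ E, Real.cosh (lam * v e' S) := by
      apply Finset.sum_congr rfl
      intro S _
      rw [Finset.prod_insert he]; ring
    have hupd : ∀ c : ℝ, (c = 1 ∨ c = -1) → ∀ x, Function.update σ e c x = 1 ∨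
        Function.update σ e c x = -1 := by
      intro c hc x
      by_cases h : x = e
      · subst h; simpa using hc
      · simpa [Function.update_of_ne h] using hσ x
    have hsum : ∑ S ∈ 𝒮, w S * Real.cosh (lam * (1 * v e S + ∑ e' ∈ E, σ e' * v e' S))
        + ∑ S ∈ 𝒮, w S * Real.cosh (lam * ((-1) * v e S + ∑ e' ∈ E, σ e' * v e' S))
        = 2 * ∑ S ∈ 𝒮, w S * Real.cosh (lam * v e S) *
          Real.cosh (lam * ∑ e' ∈ E, σ e' * v e' S) := by
      rw [← Finset.sum_add_distrib, Finset.mul_sum]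
      apply Finset.sum_congr rfl
      intro S _
      have h1 : lam * (1 * v e S + ∑ e' ∈ E, σ e' * v e' S)
        = lam * ∑ e' ∈ E, σ e' * v e' S + lam * v e S := by ring
      have h2 : lam * ((-1) * v e S + ∑ e' ∈ E, σ e' * v e' S)
        = lam * ∑ e' ∈ E, σ e' * v e' S - lam * v e S := by ring
      rw [h1, h2, Real.cosh_add, Real.cosh_sub]; ring
    rw [hprod]
    by_cases hc : ∑ S ∈ 𝒮, w S * Real.cosh (lam * (1 * v e S + ∑ e' ∈ E, σ e' * v e' S)) ≤
        ∑ S ∈ 𝒮, w S * Real.cosh (lam * v e S) * Real.cosh (lam * ∑ e' ∈ E, σ e' * v e' S)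
    · refine ⟨Function.update σ e 1, hupd 1 (Or.inl rfl), ?_⟩
      simp only [key]
      exact hc.trans hle
    · refine ⟨Function.update σ e (-1), hupd (-1) (Or.inr rfl), ?_⟩
      simp only [key]
      push Not at hc
      linarith

theorem pt1 {V : Type*} [DecidableEq V] (e S : Finset V) (x y : V) (h : e = {x, y}) :
    ((if x ∈ S then (1:ℝ) else 0) - (if y ∈ S then (1:ℝ) else 0)) ^ 2
      = if e.card = 2 ∧ (S ∩ e).card = 1 then (1:ℝ) else 0 := by
  by_cases hxy : x = y
  · have : e.card = 1 := by rw [h, hxy]; simp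
    simp [this, hxy]
  · have h2 : e.card = 2 := by rw [h]; exact Finset.card_pair hxy
    rw [h2, h]
    by_cases h1 : x ∈ S <;> by_cases h3 : y ∈ S <;>
      simp [h1, h3, Finset.inter_insert_of_mem, Finset.inter_insert_of_notMem,
        Finset.inter_singleton_of_mem, Finset.inter_singleton_of_notMem, hxy]

theorem pt2 {V : Type*} [DecidableEq V] (e S : Finset V) (x y : V) (s : ℝ) (hs : s = 1 ∨ s = -1)
    (h : e = {x, y}) :
    2 * (if (if s = 1 then x else y) ∈ S then (1:ℝ) else 0) = ((e ∩ S).card : ℝ)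
      + s * ((if x ∈ S then (1:ℝ) else 0) - (if y ∈ S then (1:ℝ) else 0))
      + if e.card = 1 then ((e ∩ S).card : ℝ) else 0 := by
  by_cases hxy : x = y
  · subst hxy
    subst h
    by_cases h1 : x ∈ S <;> simp [h1] <;> norm_num
  · have h2 : e.card = 2 := by rw [h]; exact Finset.card_pair hxy
    rw [h2, h]
    have hne : ¬ ((-1:ℝ) = 1) := by norm_num
    rcases hs with rfl | rfl <;>
    by_cases h1 : x ∈ S <;> by_cases h3 : y ∈ S <;>
      simp [h1, h3, hne, Finset.insert_inter_of_mem, Finset.insert_inter_of_notMem,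
        Finset.singleton_inter_of_mem, Finset.singleton_inter_of_notMem, hxy] <;> norm_num

set_option maxHeartbeats 600000 in
theorem halving {V : Type*} [DecidableEq V] (Y : Finset V) (𝒮 : Finset (Finset V))
    (M : Finset (Finset V)) (hM : IsPerfectMatching Y M) (K lam : ℝ) (hlam : 0 < lam)
    (hK : ∀ S ∈ 𝒮, (crossCount M S : ℝ) ≤ K) :
    ∃ A ⊆ Y, (Y.card = 2 * A.card ∨ Y.card + 1 = 2 * A.card) ∧
      ∀ S ∈ 𝒮, ∃ D l : ℝ, |D| ≤ Real.log (2 * 𝒮.card) / lam + lam * K / 2 ∧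
        0 ≤ l ∧ l ≤ 2 * A.card - Y.card ∧ 2 * ((A ∩ S).card : ℝ) = (Y ∩ S).card + D + l := by
  obtain ⟨h12, hdis, hun, hloop⟩ := hM
  have hxy : ∀ e : Finset V, ∃ p : Option (V × V), e ∈ M → ∃ x y, p = some (x, y) ∧ e = {x, y} := by
    intro e
    by_cases he : e ∈ M
    · rcases h12 e he with h | h
      · obtain ⟨x, y, _, rfl⟩ := Finset.card_eq_two.1 h
        exact ⟨some (x, y), fun _ => ⟨x, y, rfl, rfl⟩⟩
      · obtain ⟨x, rfl⟩ := Finset.card_eq_one.1 h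
        exact ⟨some (x, x), fun _ => ⟨x, x, rfl, by simp⟩⟩
    · exact ⟨none, fun h => absurd h he⟩
  rcases Y.eq_empty_or_nonempty with rfl | ⟨v0, hv0⟩
  · refine ⟨∅, by simp, by simp, fun S hS => ⟨0, 0, ?_, le_rfl, by simp, by simp⟩⟩
    have h0 : (0:ℝ) ≤ K := (Nat.cast_nonneg _).trans (hK S hS)
    have h1 : (1:ℝ) ≤ 𝒮.card := by exact_mod_cast Finset.card_pos.2 ⟨S, hS⟩
    have h2 : 0 ≤ Real.log (2 * 𝒮.card) := Real.log_nonneg (by linarith)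
    rw [abs_zero]; positivity
  have hxy' : ∀ e : Finset V, ∃ p : V × V, e ∈ M → e = {p.1, p.2} := by
    intro e
    obtain ⟨p, hp⟩ := hxy e
    by_cases he : e ∈ M
    · obtain ⟨x, y, _, h⟩ := hp he
      exact ⟨(x, y), fun _ => h⟩
    · exact ⟨(v0, v0), fun h => absurd h he⟩
  choose q hq using hxy'
  let ind : V → Finset V → ℝ := fun x S => if x ∈ S then 1 else 0
  let v : Finset V → Finset V → ℝ := fun e S => ind (q e).1 S - ind (q e).2 S
  obtain ⟨σ, hσ, hle⟩ := sign_lemma M 𝒮 v lam (fun _ => 1)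
  let p : Finset V → V := fun e => if σ e = 1 then (q e).1 else (q e).2
  have hpe : ∀ e ∈ M, p e ∈ e := by
    intro e he
    have h : p e ∈ ({(q e).1, (q e).2} : Finset V) := by
      simp only [p]
      split_ifs <;> simp
    exact (Finset.ext_iff.1 (hq e he) _).2 h
  have hinj : Set.InjOn p M := by
    intro e he f hf hef
    by_contra hne
    have := hdis he hf hne
    exact Finset.disjoint_left.1 this (hpe e he) (by simpa [hef] using hpe f hf)
  have hYS : ∀ S : Finset V, ((Y ∩ S).card : ℝ) = ∑ e ∈ M, ((e ∩ S).card : ℝ) := by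
    intro S
    rw [← hun, Finset.biUnion_inter, Finset.card_biUnion]
    · push_cast; rfl
    · intro e he f hf hne
      exact (hdis he hf hne).mono Finset.inter_subset_left Finset.inter_subset_left
  have hAS : ∀ S : Finset V, (((M.image p) ∩ S).card : ℝ) = ∑ e ∈ M, ind (p e) S := by
    intro S
    rw [← Finset.filter_mem_eq_inter, Finset.filter_image, Finset.card_image_of_injOn]
    · simp [ind]
    · exact hinj.mono (by intro x hx; simp at hx; exact hx.1)
  have hcA : (M.image p).card = M.card := Finset.card_image_of_injOn hinj
  have hcY : Y.card + (M.filter fun e => e.card = 1).card = 2 * M.card := by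
    rw [← hun, Finset.card_biUnion (fun e he f hf hne => hdis he hf hne), Finset.card_filter,
      ← Finset.sum_add_distrib, Finset.sum_congr rfl (g := fun _ => 2)]
    · simp [mul_comm]
    · intro e he
      rcases h12 e he with h | h <;> simp [h]
  have hcY' : (Y.card : ℝ) + (M.filter fun e => e.card = 1).card = 2 * M.card := by
    exact_mod_cast hcY
  have hvsq : ∀ S, ∑ e ∈ M, (v e S) ^ 2 = crossCount M S := by
    intro S
    unfold crossCount
    rw [Finset.card_filter]
    push_cast
    apply Finset.sum_congr rfl
    intro e he
    exact pt1 e S _ _ (hq e he)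
  have hcosh : ∀ S ∈ 𝒮, ∏ e ∈ M, Real.cosh (lam * v e S) ≤ Real.exp (lam ^ 2 * K / 2) := by
    intro S hS
    calc ∏ e ∈ M, Real.cosh (lam * v e S) ≤ ∏ e ∈ M, Real.exp ((lam * v e S) ^ 2 / 2) :=
          Finset.prod_le_prod (fun e _ => (Real.cosh_pos _).le)
            (fun e _ => Real.cosh_le_exp_half_sq _)
      _ = Real.exp (lam ^ 2 * crossCount M S / 2) := by
          rw [← Real.exp_sum, ← hvsq S, Finset.mul_sum, Finset.sum_div]
          congr 1
          apply Finset.sum_congr rfl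
          intro e _; ring
      _ ≤ _ := by
          apply Real.exp_le_exp.2
          have := hK S hS
          gcongr
  refine ⟨M.image p, ?_, ?_, ?_⟩
  · intro x hx
    obtain ⟨e, he, rfl⟩ := Finset.mem_image.1 hx
    rw [← hun]
    exact Finset.mem_biUnion.2 ⟨e, he, hpe e he⟩
  · rw [hcA]; omega
  intro S hS
  refine ⟨∑ e ∈ M, σ e * v e S, ∑ e ∈ M.filter (fun e => e.card = 1), ((e ∩ S).card : ℝ),
    ?_, ?_, ?_, ?_⟩
  · set D := ∑ e ∈ M, σ e * v e S with hD
    have hm : (1:ℝ) ≤ 𝒮.card := by exact_mod_cast Finset.card_pos.2 ⟨S, hS⟩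
    have h1 : Real.cosh (lam * D) ≤ 𝒮.card * Real.exp (lam ^ 2 * K / 2) := by
      calc Real.cosh (lam * D) ≤ ∑ S ∈ 𝒮, 1 * Real.cosh (lam * ∑ e ∈ M, σ e * v e S) := by
            have := Finset.single_le_sum
              (f := fun S => 1 * Real.cosh (lam * ∑ e ∈ M, σ e * v e S))
              (fun S _ => by have := Real.cosh_pos (lam * ∑ e ∈ M, σ e * v e S); linarith) hS
            simpa [hD] using this
        _ ≤ ∑ S ∈ 𝒮, 1 * ∏ e ∈ M, Real.cosh (lam * v e S) := hle
        _ ≤ ∑ S ∈ 𝒮, Real.exp (lam ^ 2 * K / 2) :=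
            Finset.sum_le_sum (fun S hS => by rw [one_mul]; exact hcosh S hS)
        _ = _ := by simp
    have h2 : Real.exp (lam * |D|) ≤ 2 * Real.cosh (lam * D) := by
      rw [← Real.cosh_abs, abs_mul, abs_of_pos hlam, Real.cosh_eq]
      have := Real.exp_pos (-(lam * |D|))
      linarith
    have h3 : Real.exp (lam * |D|) ≤ Real.exp (Real.log (2 * 𝒮.card) + lam ^ 2 * K / 2) := by
      rw [Real.exp_add, Real.exp_log (by linarith)]
      linarith
    have h4 := Real.exp_le_exp.1 h3
    have : |D| ≤ (Real.log (2 * 𝒮.card) + lam ^ 2 * K / 2) / lam := by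
      rw [le_div_iff₀ hlam]; linarith
    refine this.trans (le_of_eq ?_)
    rw [add_div]
    congr 1
    rw [div_eq_iff hlam.ne']
    ring
  · exact Finset.sum_nonneg (fun e _ => Nat.cast_nonneg _)
  · rw [hcA]
    have : ∑ e ∈ M.filter (fun e => e.card = 1), ((e ∩ S).card : ℝ)
        ≤ ∑ e ∈ M.filter (fun e => e.card = 1), 1 := by
      apply Finset.sum_le_sum
      intro e he
      have h1 := (Finset.mem_filter.1 he).2
      have h2 : (e ∩ S).card ≤ e.card := Finset.card_le_card Finset.inter_subset_left
      rw [h1] at h2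
      exact_mod_cast h2
    simp only [Finset.sum_const, nsmul_eq_mul, mul_one] at this
    linarith
  · rw [hAS, hYS, Finset.sum_filter, Finset.mul_sum, ← Finset.sum_add_distrib,
      ← Finset.sum_add_distrib]
    apply Finset.sum_congr rfl
    intro e he
    exact pt2 e S _ _ _ (hσ e) (hq e he)

theorem err_bound (n n' s t D l : ℝ) (hn : 0 < n) (hs0 : 0 ≤ s) (hsn : s ≤ n) (hl0 : 0 ≤ l)
    (hl1 : l ≤ 2 * n' - n) (h1 : 2 * n' - n ≤ 1) (ht : 2 * t = s + D + l) :
    |s / n - t / n'| ≤ (|D| + 1) / n := by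
  have hn' : 0 < n' := by linarith
  have e1 : s / n - t / n' = ((2 * n' - n) * s - n * (D + l)) / (2 * n' * n) := by
    have : t = (s + D + l) / 2 := by linarith
    rw [this]; field_simp; ring
  rw [e1, abs_div, abs_of_pos (show 0 < 2 * n' * n by positivity), div_le_div_iff₀ (by positivity) hn]
  have hb : |(2 * n' - n) * s - n * (D + l)| ≤ n * (|D| + 1) := by
    have e2 : (2 * n' - n) * s - n * (D + l) = ((2 * n' - n) * s - n * l) - n * D := by ring
    have e3 : |(2 * n' - n) * s - n * l| ≤ n := by
      rw [abs_le]; constructor <;> nlinarith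
    rw [e2]
    calc _ ≤ |(2 * n' - n) * s - n * l| + |n * D| := abs_sub _ _
      _ ≤ n + n * |D| := by rw [abs_mul, abs_of_pos hn]; linarith
      _ = _ := by ring
  have h0 : 0 ≤ |D| + 1 := by positivity
  calc _ ≤ n * (|D| + 1) * n := by gcongr
    _ ≤ (|D| + 1) * (2 * n' * n) := by nlinarith [mul_nonneg (mul_nonneg h0 hn.le) (show 0 ≤ 2 * n' - n by linarith)]

theorem iterate {V : Type*} [DecidableEq V] (X : Finset V) (𝒮 : Finset (Finset V))
    (T ε L : ℝ) (hε0 : 0 < ε) (hε1 : ε < 1) (hL : 0 < L) (hLm : Real.log (2 * 𝒮.card) ≤ 5 / 4 * L)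
    (hT : 36 ≤ T * ε)
    (H : ∀ Y ⊆ X, T ≤ Y.card → ∃ M, IsPerfectMatching Y M ∧
      ∀ S ∈ 𝒮, (crossCount M S : ℝ) ≤ Y.card * T * ε ^ 2 / (66 * L)) :
    ∀ n : ℕ, ∀ Y ⊆ X, Y.card = n → T + 1 / 2 ≤ n → ∃ A ⊆ Y, (A.card : ℝ) ≤ 2 * T + 1 ∧
      ∀ S ∈ 𝒮, |((Y ∩ S).card : ℝ) / Y.card - ((A ∩ S).card : ℝ) / A.card| ≤
        ε - 0.56 * ε * √(T / (n - 1)) := by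
  have hT36 : 36 ≤ T := by nlinarith
  intro n
  induction n using Nat.strong_induction_on with
  | _ n ih =>
  intro Y hY hYn hn
  by_cases hsmall : (n : ℝ) ≤ 2 * T + 1
  · refine ⟨Y, subset_rfl, by rw [hYn]; exact hsmall, fun S _ => ?_⟩
    rw [sub_self, abs_zero]
    have : √(T / (n - 1)) ≤ 1.5 := by
      apply Real.sqrt_le_iff.2
      refine ⟨by norm_num, ?_⟩
      rw [div_le_iff₀ (by linarith)]; linarith
    nlinarith
  push Not at hsmall
  obtain ⟨M, hM, hMc⟩ := H Y hY (by rw [hYn]; linarith)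
  rw [hYn] at hMc
  set R := √(n * T) with hR
  have hn0 : (0:ℝ) < n := by linarith
  have hT0 : 0 < T := by linarith
  have hRpos : 0 < R := by positivity
  have hR2 : R ^ 2 = n * T := Real.sq_sqrt (by positivity)
  have hRT : T ≤ R := by
    apply Real.le_sqrt_of_sq_le; nlinarith
  obtain ⟨A', hA'Y, hcard, hA'⟩ := halving Y 𝒮 M hM _ (12 * L / (ε * R)) (by positivity) hMc
  have hDb : Real.log (2 * 𝒮.card) / (12 * L / (ε * R)) + (12 * L / (ε * R)) *
      (n * T * ε ^ 2 / (66 * L)) / 2 ≤ 0.196 * ε * R := by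
    have e1 : Real.log (2 * 𝒮.card) / (12 * L / (ε * R)) ≤ 5 / 48 * (ε * R) := by
      rw [div_le_iff₀ (by positivity)]
      calc _ ≤ 5 / 4 * L := hLm
        _ = _ := by field_simp; norm_num
    have e2 : (12 * L / (ε * R)) * (n * T * ε ^ 2 / (66 * L)) / 2 = 1 / 11 * (ε * R) := by
      rw [← hR2]; field_simp; norm_num
    rw [e2]
    have : 0 < ε * R := by positivity
    linarith
  rw [hYn] at hcard
  have hc1 : (n : ℝ) ≤ 2 * A'.card := by
    have : n ≤ 2 * A'.card := by omega
    exact_mod_cast this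
  have hc2 : 2 * (A'.card : ℝ) ≤ n + 1 := by
    have : 2 * A'.card ≤ n + 1 := by omega
    exact_mod_cast this
  have hlt : A'.card < n := by
    have : (A'.card : ℝ) < n := by linarith
    exact_mod_cast this
  obtain ⟨A, hAA', hAc, hA⟩ := ih A'.card hlt A' (hA'Y.trans hY) rfl (by linarith)
  refine ⟨A, hAA'.trans hA'Y, hAc, fun S hS => ?_⟩
  obtain ⟨D, l, hD, hl0, hl1, heq⟩ := hA' S hS
  rw [hYn] at hl1
  have hsn : ((Y ∩ S).card : ℝ) ≤ n := by
    rw [← hYn]; exact_mod_cast Finset.card_le_card Finset.inter_subset_left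
  have hstep := err_bound n A'.card (Y ∩ S).card (A' ∩ S).card D l hn0 (by positivity) hsn hl0 hl1
    (by linarith) heq
  have hsA := hA S hS
  rw [hYn]
  have htri := abs_sub_le (((Y ∩ S).card : ℝ) / n) (((A' ∩ S).card : ℝ) / A'.card)
    (((A ∩ S).card : ℝ) / A.card)
  set r := √(T / (n - 1)) with hr
  have hr0 : 0 ≤ r := Real.sqrt_nonneg _
  have hcost : (|D| + 1) / n ≤ 0.224 * ε * r := by
    have h1 : |D| + 1 ≤ 0.224 * ε * R := by
      have : 1 ≤ 0.028 * (ε * R) := by nlinarith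
      linarith
    have h2 : R / n ≤ r := by
      apply Real.le_sqrt_of_sq_le
      rw [div_pow, hR2]
      rw [div_le_div_iff₀ (by positivity) (by linarith)]
      nlinarith [mul_pos hn0 hT0]
    calc (|D| + 1) / n ≤ 0.224 * ε * R / n := by gcongr
      _ = 0.224 * ε * (R / n) := by ring
      _ ≤ _ := by gcongr
  have hpot : 1.4 * r ≤ √(T / (A'.card - 1)) := by
    apply Real.le_sqrt_of_sq_le
    rw [mul_pow, hr, Real.sq_sqrt (div_nonneg hT0.le (by linarith))]
    rw [← mul_div_assoc, div_le_div_iff₀ (by linarith) (by linarith)]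
    nlinarith
  have : 0.56 * ε * (1.4 * r) ≤ 0.56 * ε * √(T / (A'.card - 1)) := by gcongr
  nlinarith [mul_nonneg hε0.le hr0]

/-- existence form of the ε-approximation corollary: under MainAssumption(a,b,γ)
with `0 < γ < 1` and `X ∈ 𝒮`, for any `ε ∈ (0,1)` there is an ε-approximation `A ⊆ X` of size at
most `2·max{(30·√(a·ln m/γ)·(1/ε))^{2/(2−γ)}, 12·√((b/2 + 12·ln m)·ln m·log₂ n)/ε} + 1`. -/
theorem stmt_4 {V : Type*} [DecidableEq V] (a b γ : ℝ) (hγ0 : 0 < γ) (hγ1 : γ < 1)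
    (X : Finset V) (𝒮 : Finset (Finset V)) (hS : ∀ S ∈ 𝒮, S ⊆ X) (hX : X ∈ 𝒮)
    (hMA : MainAssumption X 𝒮 a b γ) (ε : ℝ) (hε0 : 0 < ε) (hε1 : ε < 1) :
    ∃ A ⊆ X,
      (A.card : ℝ) ≤
        2 * max ((30 * Real.sqrt (a * Real.log 𝒮.card / γ) * (1 / ε)) ^ (2 / (2 - γ)))
            (12 * Real.sqrt ((b / 2 + 12 * Real.log 𝒮.card) * Real.log 𝒮.card
              * Real.logb 2 X.card) / ε) + 1 ∧
      ∀ S ∈ 𝒮, |(S.card : ℝ) / X.card - ((A ∩ S).card : ℝ) / A.card| ≤ ε := by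
  obtain ⟨hnm, hm34, hMat⟩ := hMA
  have hn2 : 2 ≤ X.card := by
    have h1 : 𝒮 ⊆ X.powerset := fun S h => Finset.mem_powerset.2 (hS S h)
    have h2 := Finset.card_le_card h1
    rw [Finset.card_powerset] at h2
    by_contra hlt
    have : 2 ^ X.card ≤ 2 ^ 1 := Nat.pow_le_pow_right (by norm_num) (by omega)
    omega
  have hb : 0 ≤ b := by
    obtain ⟨M, _, hM⟩ := hMat ∅ (by simp)
    have := hM X hX
    have h0 : (0:ℝ) ≤ crossCount M X := Nat.cast_nonneg _
    simp [Real.zero_rpow hγ0.ne'] at this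
    linarith
  have hm : (34:ℝ) ≤ 𝒮.card := by exact_mod_cast hm34
  have hn2' : (2:ℝ) ≤ X.card := by exact_mod_cast hn2
  set m : ℝ := (𝒮.card : ℝ) with hmdef
  set L := Real.log m with hLdef
  have hL4 : 4 * Real.log 2 ≤ L := by
    have : 4 * Real.log 2 = Real.log 16 := by
      rw [show (16:ℝ) = 2 ^ 4 by norm_num, Real.log_pow]; norm_num
    rw [this]
    exact Real.log_le_log (by norm_num) (by linarith)
  have hl2 := Real.log_two_gt_d9
  have hL1 : 1 ≤ L := by linarith
  have hLm : Real.log (2 * m) ≤ 5 / 4 * L := by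
    rw [Real.log_mul (by norm_num) (by linarith)]; linarith
  have hlogb : 1 ≤ Real.logb 2 X.card := by
    rw [Real.le_logb_iff_rpow_le (by norm_num) (by linarith)]; simpa using hn2'
  set G := Real.logb 2 X.card with hG
  set Q := 30 * √(a * L / γ) * (1 / ε) with hQ
  set P := 12 * √((b / 2 + 12 * L) * L * G) / ε with hP
  set T := max (Q ^ (2 / (2 - γ))) P with hTdef
  have hPT : P ≤ T := le_max_right _ _
  have hQT : Q ^ (2 / (2 - γ)) ≤ T := le_max_left _ _
  have hT : 36 ≤ T * ε := by
    have h1 : 3 ≤ √((b / 2 + 12 * L) * L * G) := by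
      apply Real.le_sqrt_of_sq_le
      have : 12 ≤ (b / 2 + 12 * L) * L := by nlinarith
      nlinarith
    have h2 : 36 ≤ P * ε := by
      rw [hP, div_mul_cancel₀ _ hε0.ne']; linarith
    nlinarith
  have hT0 : 0 < T := by
    by_contra h
    push Not at h
    nlinarith
  have hTb : b * (72 * L) ≤ T ^ 2 * ε ^ 2 := by
    have h1 : P * ε = 12 * √((b / 2 + 12 * L) * L * G) := by
      rw [hP, div_mul_cancel₀ _ hε0.ne']
    have h0 : 0 ≤ (b / 2 + 12 * L) * L := by positivity
    have h2 : (P * ε) ^ 2 = 144 * ((b / 2 + 12 * L) * L * G) := by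
      rw [h1, mul_pow, Real.sq_sqrt (by positivity)]; norm_num
    have h3 : P * ε ≤ T * ε := by gcongr
    have h4 : 0 ≤ P * ε := by rw [h1]; positivity
    have h5 : (P * ε) ^ 2 ≤ (T * ε) ^ 2 := by gcongr
    nlinarith [mul_le_mul_of_nonneg_left hlogb h0]
  have hTa : a * T ^ γ * (900 * L) ≤ T ^ 2 * ε ^ 2 := by
    rcases le_or_gt a 0 with ha | ha
    · have : 0 < T ^ γ := Real.rpow_pos_of_pos hT0 _
      have : a * T ^ γ * (900 * L) ≤ 0 :=
        mul_nonpos_of_nonpos_of_nonneg (mul_nonpos_of_nonpos_of_nonneg ha this.le) (by linarith)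
      have : 0 ≤ T ^ 2 * ε ^ 2 := by positivity
      linarith
    have hg : 0 < 2 - γ := by linarith
    have hQ0 : 0 ≤ Q := by positivity
    have h1 : Q ^ 2 ≤ T ^ (2 - γ) := by
      have := Real.rpow_le_rpow (by positivity) hQT hg.le
      rw [← Real.rpow_mul hQ0, div_mul_cancel₀ _ hg.ne'] at this
      exact_mod_cast this
    have h2 : Q ^ 2 = 900 * (a * L / γ) / ε ^ 2 := by
      rw [hQ, mul_pow, mul_pow, Real.sq_sqrt (by positivity)]
      field_simp; norm_num
    have h3 : 900 * (a * L) ≤ Q ^ 2 * ε ^ 2 := by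
      rw [h2, div_mul_cancel₀ _ (by positivity)]
      have : a * L ≤ a * L / γ := by
        rw [le_div_iff₀ hγ0]
        nlinarith [mul_pos ha (show 0 < L by linarith)]
      linarith
    have h4 : T ^ (2 - γ) * T ^ γ = T ^ 2 := by
      rw [← Real.rpow_add hT0]; norm_num
    have h5 : 0 < T ^ γ := Real.rpow_pos_of_pos hT0 _
    calc a * T ^ γ * (900 * L) = 900 * (a * L) * T ^ γ := by ring
      _ ≤ (T ^ (2 - γ) * ε ^ 2) * T ^ γ := by
          exact mul_le_mul_of_nonneg_right (h3.trans (by gcongr)) h5.le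
      _ = (T ^ (2 - γ) * T ^ γ) * ε ^ 2 := by ring
      _ = _ := by rw [h4]
  clear_value T P Q G
  have H : ∀ Y ⊆ X, T ≤ Y.card → ∃ M, IsPerfectMatching Y M ∧
      ∀ S ∈ 𝒮, (crossCount M S : ℝ) ≤ Y.card * T * ε ^ 2 / (66 * L) := by
    intro Y hY hTY
    obtain ⟨M, hM, hc⟩ := hMat Y hY
    refine ⟨M, hM, fun S hSS => (hc S hSS).trans ?_⟩
    set y : ℝ := (Y.card : ℝ) with hy
    have hy0 : 0 < y := by linarith
    rw [le_div_iff₀ (by positivity)]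
    have hb2 : b * (72 * L) ≤ y * T * ε ^ 2 := hTb.trans (by
      have : T ^ 2 ≤ y * T := by nlinarith
      gcongr)
    have ha2 : a * y ^ γ * (900 * L) ≤ y * T * ε ^ 2 := by
      rcases le_or_gt a 0 with ha | ha
      · have : 0 < y ^ γ := Real.rpow_pos_of_pos hy0 _
        have : a * y ^ γ * (900 * L) ≤ 0 :=
          mul_nonpos_of_nonpos_of_nonneg (mul_nonpos_of_nonpos_of_nonneg ha this.le) (by linarith)
        have : 0 ≤ y * T * ε ^ 2 := by positivity
        linarith
      have h1 : y ^ γ = T ^ γ * (y / T) ^ γ := by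
        rw [← Real.mul_rpow hT0.le (by positivity)]
        congr 1; field_simp
      have h2 : (y / T) ^ γ ≤ y / T := by
        have := Real.rpow_le_rpow_of_exponent_le ((one_le_div hT0).2 hTY) hγ1.le
        simpa using this
      have h5 : 0 < T ^ γ := Real.rpow_pos_of_pos hT0 _
      calc a * y ^ γ * (900 * L) = (a * T ^ γ * (900 * L)) * (y / T) ^ γ := by rw [h1]; ring
        _ ≤ (a * T ^ γ * (900 * L)) * (y / T) := by gcongr
        _ ≤ (T ^ 2 * ε ^ 2) * (y / T) := by gcongr
        _ = _ := by field_simp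
    have : 0 ≤ y * T * ε ^ 2 := by positivity
    linarith
  by_cases hbig : (X.card : ℝ) ≤ 2 * T + 1
  · refine ⟨X, subset_rfl, hbig, fun S h => ?_⟩
    rw [Finset.inter_eq_right.2 (hS S h), sub_self, abs_zero]
    exact hε0.le
  push Not at hbig
  obtain ⟨A, hAX, hAc, hA⟩ := iterate X 𝒮 T ε L hε0 hε1 (by linarith) hLm hT H X.card X subset_rfl
    rfl (by linarith)
  refine ⟨A, hAX, hAc, fun S h => ?_⟩
  have := hA S h
  rw [Finset.inter_eq_right.2 (hS S h)] at this
  refine this.trans ?_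
  have : 0 ≤ 0.56 * ε * √(T / (X.card - 1)) := by positivity
  linarith
end

section
/- Let (Y,R) be a finite set system with |Y| ≥ 2 even, let w : R → ℝ_{≥0} be a weight function with total weight w(R) = Σ_{R∈R} w(R), and let κ ≥ 0 be such that Y admits a perfect matching with crossing number at most κ with respect to R. Then there exists an edge {x,y} of distinct elements of Y such that Σ_{R ∈ R, R crosses {x,y}} w(R) ≤ 2·w(R)·κ / |Y|. -/
open Finset

/-- Lemma 3.2 (short-edge lemma). If `Y` (of even size ≥ 2) has a perfect matching
with crossing number at most `κ` w.r.t. `ℛ`, then for any nonnegative weights `w` on `ℛ` there is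
an edge `{x,y}` crossed by ranges of total weight at most `2·w(ℛ)·κ/|Y|`. -/
theorem stmt_5 {V : Type*} [DecidableEq V] (Y : Finset V) (ℛ : Finset (Finset V))
    (hR : ∀ R ∈ ℛ, R ⊆ Y) (hY2 : 2 ≤ Y.card) (hYeven : Even Y.card)
    (w : Finset V → ℝ) (hw : ∀ R ∈ ℛ, 0 ≤ w R)
    (κ : ℝ) (hκ0 : 0 ≤ κ)
    (M : Finset (Finset V)) (hM : IsPerfectMatching Y M)
    (hMκ : ∀ R ∈ ℛ, (crossCount M R : ℝ) ≤ κ) :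
    ∃ x ∈ Y, ∃ y ∈ Y, x ≠ y ∧
      ∑ R ∈ ℛ.filter (fun R => (R ∩ ({x, y} : Finset V)).card = 1), w R ≤
        2 * (∑ R ∈ ℛ, w R) * κ / Y.card := by
  obtain ⟨h1, h2, h3, h4⟩ := hM
  have hcard : Y.card = ∑ e ∈ M, e.card := by
    rw [← h3, Finset.card_biUnion (fun a ha b hb hab => h2 ha hb hab)]
    rfl
  have hsplit := Finset.sum_filter_add_sum_filter_not M (fun e => e.card = 1) (fun e => e.card)
  have hA : ∑ e ∈ M with e.card = 1, e.card = (M.filter fun e => e.card = 1).card := by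
    rw [Finset.card_eq_sum_ones]
    exact Finset.sum_congr rfl (fun e he => (Finset.mem_filter.mp he).2)
  have hN : (M.filter fun e => ¬ e.card = 1) = M.filter fun e => e.card = 2 := by
    apply Finset.filter_congr
    intro e he
    have := h1 e he
    omega
  have hB : ∑ e ∈ M with e.card = 2, e.card = (M.filter fun e => e.card = 2).card * 2 :=
    Finset.sum_const_nat (fun e he => (Finset.mem_filter.mp he).2)
  rw [hN, hA, hB, ← hcard] at hsplit
  have hY : Y.card = (M.filter fun e => e.card = 2).card * 2 := by
    obtain ⟨k, hk⟩ := hYeven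
    omega
  set N := M.filter fun e => e.card = 2 with hNdef
  have hNpos : 0 < N.card := by omega
  have hsum : ∑ e ∈ N, ∑ R ∈ ℛ.filter (fun R => (R ∩ e).card = 1), w R
      ≤ (∑ R ∈ ℛ, w R) * κ := by
    simp_rw [Finset.sum_filter]
    rw [Finset.sum_comm, Finset.sum_mul]
    apply Finset.sum_le_sum
    intro R hRR
    have hc : ∑ e ∈ N, (if (R ∩ e).card = 1 then w R else 0) = w R * (crossCount M R : ℝ) := by
      rw [← Finset.sum_filter, Finset.sum_const, nsmul_eq_mul, mul_comm, hNdef,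
        Finset.filter_filter]
      rfl
    rw [hc]
    exact mul_le_mul_of_nonneg_left (hMκ R hRR) (hw R hRR)
  have hYr : (Y.card : ℝ) = N.card * 2 := by exact_mod_cast hY
  have hNr : (0 : ℝ) < N.card := by exact_mod_cast hNpos
  obtain ⟨e, he, hle⟩ := Finset.exists_le_of_sum_le (s := N)
    (f := fun e => ∑ R ∈ ℛ.filter (fun R => (R ∩ e).card = 1), w R)
    (g := fun _ => 2 * (∑ R ∈ ℛ, w R) * κ / Y.card) (Finset.card_pos.mp hNpos) (by
      rw [Finset.sum_const, nsmul_eq_mul, hYr]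
      refine hsum.trans (le_of_eq ?_)
      field_simp)
  have heM := Finset.mem_filter.mp he
  obtain ⟨x, y, hxy, rfl⟩ := Finset.card_eq_two.mp heM.2
  have hsub : ({x, y} : Finset V) ⊆ Y := by
    rw [← h3]
    exact Finset.subset_biUnion_of_mem id heM.1
  exact ⟨x, hsub (by simp), y, hsub (by simp), hxy, hle⟩
end

section
/- Let (X,S) be a finite set system with |X| = n and X ∈ S, let χ : X → {−1,1} be a two-coloring with discrepancy disc_S(χ) = Δ, and let A ⊆ X be any set of ⌈n/2⌉ elements taken from the larger color class of χ. Then A is a (2Δ/n)-approximation of (X,S), i.e., for every S ∈ S, | |S|/n − |A∩S|/|A| | ≤ 2Δ/n. -/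
theorem core_sum {V : Type*} [DecidableEq V] (S : Finset V) (χ : V → ℤ)
    (hχ : ∀ x ∈ S, χ x = 1 ∨ χ x = -1) :
    ∑ x ∈ S, χ x = 2 * ((S.filter fun x => χ x = 1).card : ℤ) - S.card := by
  have h : ∀ x ∈ S, χ x = 2 * (if χ x = 1 then 1 else 0) - 1 := by
    intro x hx
    rcases hχ x hx with h | h <;> simp [h]
  rw [Finset.sum_congr rfl h, Finset.sum_sub_distrib, ← Finset.mul_sum]
  simp

theorem core_apx {V : Type*} [DecidableEq V] (X S : Finset V) (hS : S ⊆ X)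
    (χ : V → ℤ) (hχ : ∀ x ∈ X, χ x = 1 ∨ χ x = -1)
    (Δ : ℤ) (h1 : |∑ x ∈ S, χ x| ≤ Δ) (h2 : |∑ x ∈ X, χ x| ≤ Δ)
    (A : Finset V) (hAcard : A.card = (X.card + 1) / 2)
    (hA : A ⊆ X.filter fun x => χ x = 1) :
    |(S.card : ℝ) / X.card - ((A ∩ S).card : ℝ) / A.card| ≤ 2 * (Δ : ℝ) / X.card := by
  rw [core_sum S χ (fun x hx => hχ x (hS hx))] at h1
  rw [core_sum X χ hχ] at h2
  have ha : (A ∩ S).card ≤ A.card := Finset.card_le_card Finset.inter_subset_left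
  have ha1 : (A ∩ S).card ≤ (S.filter fun x => χ x = 1).card := by
    apply Finset.card_le_card
    intro x hx
    have := hA (Finset.mem_inter.1 hx).1
    simp_all
  have ha2 : (S.filter fun x => χ x = 1).card + A.card
      ≤ (A ∩ S).card + (X.filter fun x => χ x = 1).card := by
    have hsub : (S.filter fun x => χ x = 1) ∪ A ⊆ X.filter fun x => χ x = 1 :=
      Finset.union_subset (Finset.filter_subset_filter _ hS) hA
    have hi : (S.filter fun x => χ x = 1) ∩ A ⊆ A ∩ S := by
      intro x hx
      simp_all
    have e := Finset.card_union_add_card_inter (S.filter fun x => χ x = 1) A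
    have := Finset.card_le_card hsub
    have := Finset.card_le_card hi
    omega
  generalize (A ∩ S).card = a at *
  generalize (S.filter fun x => χ x = 1).card = sp at *
  generalize (X.filter fun x => χ x = 1).card = p at *
  generalize S.card = s at *
  rw [abs_le] at h1 h2
  rcases Nat.eq_zero_or_pos X.card with h0 | hpos
  · have : A.card = 0 := by omega
    simp [h0, this]
  generalize A.card = m at *
  generalize X.card = n at *
  have hn : (0:ℝ) < n := by exact_mod_cast hpos
  have hm : (0:ℝ) < m := by
    have : 0 < m := by omega
    exact_mod_cast this
  have ham : (a:ℝ) / m ≤ 1 := by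
    rw [div_le_one hm]; exact_mod_cast ha
  have ham0 : 0 ≤ (a:ℝ) / m := by positivity
  have key : (s:ℝ) / n - a / m = (s - n * (a / m)) / n := by
    field_simp
  rw [key, abs_div, abs_of_pos hn]
  apply div_le_div_of_nonneg_right _ hn.le
  have hmul : (m:ℝ) * (a / m) = a := by field_simp
  rcases Nat.even_or_odd' n with ⟨k, hk | hk⟩
  · have hmk : m = k := by omega
    have e : (n:ℝ) * (a / m) = 2 * a := by
      rw [hk, ← hmk]; push_cast; linarith
    have b1 : -(2 * Δ) ≤ (s:ℤ) - 2 * a := by omega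
    have b2 : (s:ℤ) - 2 * a ≤ 2 * Δ := by omega
    rw [e, abs_le]
    exact ⟨by exact_mod_cast b1, by exact_mod_cast b2⟩
  · have hmk : m = k + 1 := by omega
    have e : (n:ℝ) * (a / m) = 2 * a - a / m := by
      have : (n:ℝ) = 2 * m - 1 := by rw [hk, hmk]; push_cast; ring
      rw [this]; linarith
    have b1 : -(2 * Δ) ≤ (s:ℤ) - 2 * a := by omega
    have b2 : (s:ℤ) - 2 * a + 1 ≤ 2 * Δ := by omega
    have b1' : -(2 * (Δ:ℝ)) ≤ (s:ℝ) - 2 * a := by exact_mod_cast b1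
    have b2' : (s:ℝ) - 2 * a + 1 ≤ 2 * Δ := by exact_mod_cast b2
    rw [e, abs_le]
    constructor <;> linarith

/-- the lemma `disc-to-apx` (Matoušek–Welzl–Wernisch). If `χ` is a two-coloring of
`X` with discrepancy `Δ` (and `X ∈ 𝒮`), and `A` consists of `⌈n/2⌉` elements of the larger color
class of `χ`, then `A` is a `(2Δ/n)`-approximation of `(X, 𝒮)`. -/
theorem stmt_7 {V : Type*} [DecidableEq V] (X : Finset V) (𝒮 : Finset (Finset V))
    (hS : ∀ S ∈ 𝒮, S ⊆ X) (hX : X ∈ 𝒮)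
    (χ : V → ℤ) (hχ : ∀ x ∈ X, χ x = 1 ∨ χ x = -1)
    (Δ : ℤ) (hΔ : 𝒮.sup' ⟨X, hX⟩ (fun S => |∑ x ∈ S, χ x|) = Δ)
    (A : Finset V) (hAcard : A.card = (X.card + 1) / 2)
    (hA : ((X.filter fun x => χ x = -1).card ≤ (X.filter fun x => χ x = 1).card
            ∧ A ⊆ X.filter fun x => χ x = 1)
        ∨ ((X.filter fun x => χ x = 1).card ≤ (X.filter fun x => χ x = -1).card
            ∧ A ⊆ X.filter fun x => χ x = -1)) :
    ∀ S ∈ 𝒮, |(S.card : ℝ) / X.card - ((A ∩ S).card : ℝ) / A.card| ≤ 2 * (Δ : ℝ) / X.card := by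
  intro S hSm
  have hle : ∀ T ∈ 𝒮, |∑ x ∈ T, χ x| ≤ Δ := by
    intro T hT
    rw [← hΔ]
    exact Finset.le_sup' (fun S => |∑ x ∈ S, χ x|) hT
  rcases hA with ⟨-, hA⟩ | ⟨-, hA⟩
  · exact core_apx X S (hS S hSm) χ hχ Δ (hle S hSm) (hle X hX) A hAcard hA
  · refine core_apx X S (hS S hSm) (fun x => - χ x) ?_ Δ ?_ ?_ A hAcard ?_
    · intro x hx
      rcases hχ x hx with h | h <;> simp [h]
    · rw [Finset.sum_neg_distrib, abs_neg]; exact hle S hSm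
    · rw [Finset.sum_neg_distrib, abs_neg]; exact hle X hX
    · intro x hx
      have := hA hx
      simp only [Finset.mem_filter] at this ⊢
      exact ⟨this.1, by rw [this.2]; norm_num⟩
end

section
/- Let (X,S) be a finite set system with S nonempty, let t ≥ 1, and let e₁,…,e_t be edges of X. Define weight functions ω₁,…,ω_{t+1} : S → ℝ_{>0} by ω₁(S) = 1 for all S ∈ S and ω_{i+1}(S) = 2·ω_i(S) if S crosses e_i and ω_{i+1}(S) = ω_i(S) otherwise. Then max_{S∈S} #{ i ∈ {1,…,t} : S crosses e_i } ≤ (1/ln 2) · ( ln|S| + Σ_{j=1}^{t} τ_j / ω_j(S) ), where τ_j = Σ_{S ∈ S, S crosses e_j} ω_j(S) and ω_j(S) = Σ_{S∈S} ω_j(S) is the total weight at step j. -/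
open Finset

/-- the deterministic multiplicative-weights crossing-number bound
(Equation (CW-crnr-bound)). With doubling weight updates along edges `e₁,…,e_t`, every range is
crossed by at most `(1/ln 2)·(ln|𝒮| + Σⱼ τⱼ/ωⱼ(𝒮))` of the chosen edges, where `τⱼ` is the total
`ωⱼ`-weight of the ranges crossing `eⱼ` and `ωⱼ(𝒮)` is the total weight at step `j`. -/
theorem stmt_13 {V : Type*} [DecidableEq V] (X : Finset V) (𝒮 : Finset (Finset V))
    (hS : ∀ S ∈ 𝒮, S ⊆ X) (h𝒮ne : 𝒮.Nonempty)
    (t : ℕ) (ht : 1 ≤ t)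
    (e : ℕ → Finset V) (he : ∀ i ∈ Finset.Icc 1 t, (e i).card = 2 ∧ e i ⊆ X)
    (ω : ℕ → Finset V → ℝ)
    (hω1 : ∀ S ∈ 𝒮, ω 1 S = 1)
    (hωstep : ∀ i ∈ Finset.Icc 1 t, ∀ S ∈ 𝒮,
      ω (i + 1) S = if (S ∩ e i).card = 1 then 2 * ω i S else ω i S) :
    ∀ S₀ ∈ 𝒮,
      ((((Finset.Icc 1 t).filter fun i => (S₀ ∩ e i).card = 1).card : ℝ)) ≤
        (1 / Real.log 2) * (Real.log 𝒮.card +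
          ∑ j ∈ Finset.Icc 1 t,
            (∑ S ∈ 𝒮.filter fun S => (S ∩ e j).card = 1, ω j S) / (∑ S ∈ 𝒮, ω j S)) := by
  have hpow : ∀ n, n ≤ t → ∀ S ∈ 𝒮,
      ω (n + 1) S = 2 ^ (((Finset.Icc 1 n).filter fun i => (S ∩ e i).card = 1).card) := by
    intro n
    induction n with
    | zero => intro _ S hSm; simpa using hω1 S hSm
    | succ n ih =>
      intro hn S hSm
      have hm : n + 1 ∈ Finset.Icc 1 t := Finset.mem_Icc.mpr ⟨by omega, hn⟩
      rw [hωstep (n + 1) hm S hSm, ih (by omega) S hSm, Finset.card_filter, Finset.card_filter,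
        Finset.sum_Icc_succ_top (by omega)]
      split_ifs with h
      · rw [pow_succ]; ring
      · simp
  have hposS : ∀ n, n ≤ t → ∀ S ∈ 𝒮, 0 < ω (n + 1) S := by
    intro n hn S hSm
    rw [hpow n hn S hSm]; positivity
  have hW : ∀ n, n ≤ t → 0 < ∑ S ∈ 𝒮, ω (n + 1) S := fun n hn =>
    Finset.sum_pos (hposS n hn) h𝒮ne
  have hlog : ∀ n, n ≤ t → Real.log (∑ S ∈ 𝒮, ω (n + 1) S) ≤ Real.log 𝒮.card +
      ∑ j ∈ Finset.Icc 1 n,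
        (∑ S ∈ 𝒮.filter fun S => (S ∩ e j).card = 1, ω j S) / (∑ S ∈ 𝒮, ω j S) := by
    intro n
    induction n with
    | zero =>
      intro _
      rw [Finset.sum_congr rfl hω1]
      simp
    | succ n ih =>
      intro hn
      have hm : n + 1 ∈ Finset.Icc 1 t := Finset.mem_Icc.mpr ⟨by omega, hn⟩
      have h1 := ih (by omega)
      have hp := hW n (by omega)
      have hp2 := hW (n + 1) hn
      have hs : ∑ S ∈ 𝒮, ω (n + 1 + 1) S = (∑ S ∈ 𝒮, ω (n + 1) S) +
          ∑ S ∈ 𝒮.filter fun S => (S ∩ e (n + 1)).card = 1, ω (n + 1) S := by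
        rw [Finset.sum_filter, ← Finset.sum_add_distrib]
        refine Finset.sum_congr rfl fun S hSm => ?_
        rw [hωstep (n + 1) hm S hSm]
        split_ifs <;> ring
      rw [Finset.sum_Icc_succ_top (by omega)]
      have h2 := Real.log_le_sub_one_of_pos (div_pos hp2 hp)
      rw [Real.log_div hp2.ne' hp.ne'] at h2
      have h3 : (∑ S ∈ 𝒮, ω (n + 1 + 1) S) / (∑ S ∈ 𝒮, ω (n + 1) S) - 1 =
          (∑ S ∈ 𝒮.filter fun S => (S ∩ e (n + 1)).card = 1, ω (n + 1) S) /
            (∑ S ∈ 𝒮, ω (n + 1) S) := by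
        rw [hs, add_div, div_self hp.ne']; ring
      linarith
  intro S₀ hS₀
  have hl2 : 0 < Real.log 2 := Real.log_pos (by norm_num)
  rw [one_div, inv_mul_eq_div, le_div_iff₀ hl2]
  refine le_trans ?_ (hlog t le_rfl)
  rw [← Real.log_pow, ← hpow t le_rfl S₀ hS₀]
  exact Real.log_le_log (hposS t le_rfl S₀ hS₀)
    (Finset.single_le_sum (f := fun S => ω (t + 1) S)
      (fun S hSm => (hposS t le_rfl S hSm).le) hS₀)
end

section
/- Let d, s ≥ 1 and Δ ≥ 1 be integers, let X be a finite set of points in ℝ^d, and let (X,S) be a finite set system in which every range S ∈ S has the form S = { x ∈ X : (sgn p₁(x), …, sgn p_s(x)) ∈ Σ_S } for some real polynomials p₁,…,p_s in d variables of degree at most Δ and some set Σ_S ⊆ {−1,0,1}^s of sign patterns (the polynomials and sign-pattern set may depend on the range). Then the dual shatter function satisfies π*_S(k) ≤ (4eΔs)^d · k^d for all k ≥ 1. -/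
open Finset
open scoped Classical

lemma aux_totalDegree_pderiv {d : ℕ} (i : Fin d) (p : MvPolynomial (Fin d) ℝ) :
    (MvPolynomial.pderiv i p).totalDegree ≤ p.totalDegree := by
  rw [MvPolynomial.totalDegree, Finset.sup_le_iff]
  intro m hm
  rw [MvPolynomial.mem_support_iff, MvPolynomial.coeff_pderiv] at hm
  have h1 : m + Finsupp.single i 1 ∈ p.support := by
    rw [MvPolynomial.mem_support_iff]
    exact left_ne_zero_of_mul hm
  have h2 := MvPolynomial.le_totalDegree h1
  rw [Finsupp.sum_add_index' (by simp) (by simp)] at h2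
  omega

lemma aux_interp {d : ℕ} (Z : Finset (Fin d → ℝ)) (z : Z) :
    ∃ p : MvPolynomial (Fin d) ℝ, (fun w : Z => MvPolynomial.eval w.1 p) = Pi.single z 1 := by
  have h : ∀ w : Z, ∃ q : MvPolynomial (Fin d) ℝ, w ≠ z →
      MvPolynomial.eval w.1 q = 0 ∧ MvPolynomial.eval z.1 q = 1 := by
    intro w
    by_cases hw : w = z
    · exact ⟨0, fun h => absurd hw h⟩
    · have : ∃ i, w.1 i ≠ z.1 i := by
        by_contra hc
        push Not at hc
        exact hw (Subtype.ext (funext hc))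
      obtain ⟨i, hi⟩ := this
      have hi' : z.1 i - w.1 i ≠ 0 := sub_ne_zero.2 (Ne.symm hi)
      refine ⟨MvPolynomial.C (z.1 i - w.1 i)⁻¹ *
        (MvPolynomial.X i - MvPolynomial.C (w.1 i)), fun _ => ⟨by simp, by simp [hi']⟩⟩
  choose q hq using h
  refine ⟨∏ w ∈ Finset.univ.erase z, q w, ?_⟩
  funext w
  rw [map_prod]
  by_cases hw : w = z
  · subst hw
    rw [Pi.single_eq_same]
    exact Finset.prod_eq_one fun v hv => (hq v (Finset.ne_of_mem_erase hv)).2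
  · rw [Pi.single_eq_of_ne hw]
    exact Finset.prod_eq_zero (Finset.mem_erase.2 ⟨hw, Finset.mem_univ w⟩) (hq w hw).1

lemma aux_bezout {d M : ℕ} (h : Fin d → MvPolynomial (Fin d) ℝ)
    (hdeg : ∀ i, (h i).totalDegree < M) (Z : Finset (Fin d → ℝ))
    (hZ : ∀ z ∈ Z, ∀ i, z i ^ M = MvPolynomial.eval z (h i)) : Z.card ≤ M ^ d := by
  let b : (Fin d → Fin M) → (Z → ℝ) := fun a w => ∏ i, w.1 i ^ (a i : ℕ)
  let V := Submodule.span ℝ (Set.range b)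
  have key : ∀ n : ℕ, ∀ p : MvPolynomial (Fin d) ℝ, p.totalDegree < n →
      (fun w : Z => MvPolynomial.eval w.1 p) ∈ V := by
    intro n
    induction n with
    | zero => intro p hp; omega
    | succ n ih =>
      intro p hp
      have h1 : (fun w : Z => MvPolynomial.eval w.1 p) =
          ∑ a ∈ p.support, p.coeff a • (fun w : Z => ∏ i, w.1 i ^ a i) := by
        funext w
        rw [MvPolynomial.eval_eq']
        simp
      rw [h1]
      refine Submodule.sum_mem _ fun a ha => Submodule.smul_mem _ _ ?_
      by_cases hall : ∀ i, a i < M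
      · exact Submodule.subset_span ⟨fun i => ⟨a i, hall i⟩, rfl⟩
      · push Not at hall
        obtain ⟨i, hi⟩ := hall
        have hle : Finsupp.single i M ≤ a := by simpa using hi
        obtain ⟨c, rfl⟩ := exists_add_of_le hle
        have hda := MvPolynomial.le_totalDegree ha
        rw [Finsupp.sum_add_index' (by simp) (by simp), Finsupp.sum_single_index rfl] at hda
        have h2 : (fun w : Z => ∏ j, w.1 j ^ (Finsupp.single i M + c) j) =
            fun w : Z => MvPolynomial.eval w.1 (h i * MvPolynomial.monomial c 1) := by
          funext w
          rw [map_mul, ← hZ w.1 w.2 i, MvPolynomial.eval_monomial, one_mul,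
            Finsupp.prod_fintype _ _ (by simp)]
          simp only [Finsupp.add_apply, pow_add, Finset.prod_mul_distrib]
          congr 1
          rw [Finset.prod_eq_single i]
          · simp
          · intro j _ hj
            simp [Ne.symm hj]
          · simp
        rw [h2]
        apply ih
        have h3 := MvPolynomial.totalDegree_mul (h i) (MvPolynomial.monomial c (1:ℝ))
        have h4 : (MvPolynomial.monomial c (1:ℝ)).totalDegree ≤ c.sum fun _ e => e :=
          MvPolynomial.totalDegree_monomial_le c (1:ℝ)
        have h5 := hdeg i
        omega
  have htop : V = ⊤ := by
    rw [eq_top_iff]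
    intro f _
    have : f = ∑ z, f z • (Pi.single z 1 : Z → ℝ) := by
      funext w
      simp [Finset.sum_apply, Pi.single_apply]
    rw [this]
    refine Submodule.sum_mem _ fun z _ => Submodule.smul_mem _ _ ?_
    obtain ⟨p, hp⟩ := aux_interp Z z
    rw [← hp]
    exact key _ p (Nat.lt_succ_self _)
  have h1 := finrank_range_le_card (R := ℝ) b
  rw [Set.finrank] at h1
  change Module.finrank ℝ V ≤ _ at h1
  rw [htop, finrank_top, Module.finrank_fintype_fun_eq_card] at h1
  simpa using h1

lemma aux_bound {d D : ℕ} (p : MvPolynomial (Fin d) ℝ) (hp : p.totalDegree ≤ D) :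
    ∃ C : ℝ, 0 ≤ C ∧ ∀ x : Fin d → ℝ, 1 ≤ ‖x‖ → |MvPolynomial.eval x p| ≤ C * ‖x‖ ^ D := by
  refine ⟨∑ a ∈ p.support, |p.coeff a|, Finset.sum_nonneg fun _ _ => abs_nonneg _, ?_⟩
  intro x hx
  rw [MvPolynomial.eval_eq', Finset.sum_mul]
  refine (Finset.abs_sum_le_sum_abs _ _).trans (Finset.sum_le_sum fun a ha => ?_)
  rw [abs_mul]
  refine mul_le_mul_of_nonneg_left ?_ (abs_nonneg _)
  rw [Finset.abs_prod]
  calc ∏ i, |x i ^ a i| ≤ ∏ i, ‖x‖ ^ a i := by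
        refine Finset.prod_le_prod (fun _ _ => abs_nonneg _) fun i _ => ?_
        rw [abs_pow]
        exact pow_le_pow_left₀ (abs_nonneg _) (norm_le_pi_norm x i) _
    _ = ‖x‖ ^ (∑ i, a i) := by rw [Finset.prod_pow_eq_pow_sum]
    _ ≤ ‖x‖ ^ D := by
        refine pow_le_pow_right₀ hx ?_
        have := MvPolynomial.le_totalDegree ha
        rw [Finsupp.sum_fintype _ _ (by simp)] at this
        omega

lemma aux_hasDerivAt {d : ℕ} (p : MvPolynomial (Fin d) ℝ) (z : Fin d → ℝ) (i : Fin d) :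
    HasDerivAt (fun t : ℝ => MvPolynomial.eval (Function.update z i t) p)
      (MvPolynomial.eval z (MvPolynomial.pderiv i p)) (z i) := by
  induction p using MvPolynomial.induction_on with
  | C a => simpa using hasDerivAt_const (z i) a
  | add p q hp hq =>
    simp only [map_add]
    exact hp.add hq
  | mul_X p j hp =>
    have hX : HasDerivAt (fun t : ℝ => Function.update z i t j)
        (MvPolynomial.eval z (MvPolynomial.pderiv i (MvPolynomial.X j : MvPolynomial (Fin d) ℝ)))
        (z i) := by
      by_cases hj : j = i
      · subst hj
        simp only [Function.update_self, MvPolynomial.pderiv_X_self, map_one]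
        exact hasDerivAt_id (z j)
      · simpa [MvPolynomial.pderiv_X_of_ne hj, Function.update_of_ne hj]
          using hasDerivAt_const (z i) (z j)
    have := hp.mul hX
    simp only [Function.update_eq_self] at this
    simp only [MvPolynomial.pderiv_mul, map_add, map_mul, MvPolynomial.eval_X]
    exact this

lemma aux_crit {d : ℕ} (p : MvPolynomial (Fin d) ℝ) (z : Fin d → ℝ) (i : Fin d)
    (hz : IsLocalMin (fun x => MvPolynomial.eval x p) z) :
    MvPolynomial.eval z (MvPolynomial.pderiv i p) = 0 := by
  refine IsLocalMin.hasDerivAt_eq_zero ?_ (aux_hasDerivAt p z i)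
  have hc : Filter.Tendsto (fun t : ℝ => Function.update z i t) (nhds (z i)) (nhds z) := by
    have : Continuous (fun t : ℝ => Function.update z i t) := continuous_const.update i continuous_id
    simpa using this.tendsto (z i)
  have := hc.eventually hz
  simpa [IsLocalMin, IsMinFilter] using this

/-- the critical point -/
lemma aux_exists {d D : ℕ} {ι : Type} [Fintype ι] (g : ι → MvPolynomial (Fin d) ℝ)
    (hD : (∏ j, g j).totalDegree ≤ D) (ε : ℝ) (hε : 0 < ε) (y : Fin d → ℝ)
    (hy : ε * ∑ i, y i ^ (2 * D + 2) < MvPolynomial.eval y (∏ j, g j) ^ 2) :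
    ∃ z : Fin d → ℝ, (∀ j, 0 < MvPolynomial.eval z (g j) * MvPolynomial.eval y (g j)) ∧
      ∀ i, z i ^ (2 * D + 1) = MvPolynomial.eval z
        (MvPolynomial.C (ε * (2 * D + 2))⁻¹ * MvPolynomial.pderiv i ((∏ j, g j) ^ 2)) := by
  set f := ∏ j, g j with hf
  let G : MvPolynomial (Fin d) ℝ :=
    MvPolynomial.C ε * ∑ i, MvPolynomial.X i ^ (2 * D + 2) - f ^ 2
  have hG : ∀ x, MvPolynomial.eval x G = ε * ∑ i, x i ^ (2 * D + 2) - MvPolynomial.eval x f ^ 2 := by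
    intro x; simp [G]
  have hGc : Continuous fun x => MvPolynomial.eval x G := MvPolynomial.continuous_eval G
  have hnn : ∀ x : Fin d → ℝ, 0 ≤ ∑ i, x i ^ (2 * D + 2) := fun x =>
    Finset.sum_nonneg fun i _ => Even.pow_nonneg ⟨D + 1, by ring⟩ _
  have hGy : MvPolynomial.eval y G < 0 := by rw [hG]; linarith
  let Cl : Set (Fin d → ℝ) := {x | ∀ j, 0 ≤ MvPolynomial.eval x (g j) * MvPolynomial.eval y (g j)}
  let K : Set (Fin d → ℝ) := Cl ∩ {x | MvPolynomial.eval x G ≤ MvPolynomial.eval y G}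
  have hClc : IsClosed Cl := by
    have : Cl = ⋂ j, {x | 0 ≤ MvPolynomial.eval x (g j) * MvPolynomial.eval y (g j)} := by
      ext x; simp [Cl]
    rw [this]
    exact isClosed_iInter fun j => isClosed_le continuous_const
      ((MvPolynomial.continuous_eval (g j)).mul continuous_const)
  have hKc : IsClosed K := hClc.inter (isClosed_le hGc continuous_const)
  obtain ⟨C, hC0, hC⟩ := aux_bound f hD
  have hKb : K ⊆ Metric.closedBall 0 (1 + C ^ 2 / ε) := by
    intro x hx
    rw [mem_closedBall_zero_iff]
    have hq : 0 ≤ C ^ 2 / ε := by positivity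
    by_contra hlt
    push Not at hlt
    have hx1 : 1 ≤ ‖x‖ := by linarith
    have h1 : MvPolynomial.eval x G < 0 := lt_of_le_of_lt hx.2 hGy
    rw [hG] at h1
    have h2 : ‖x‖ ^ (2 * D + 2) ≤ ∑ i, x i ^ (2 * D + 2) := by
      have hex : ∃ i, ‖x‖ ≤ |x i| := by
        by_contra hc
        push Not at hc
        exact lt_irrefl _ ((pi_norm_lt_iff (by linarith)).2 hc)
      obtain ⟨i, hi⟩ := hex
      refine (pow_le_pow_left₀ (norm_nonneg x) hi _).trans ?_
      rw [Even.pow_abs ⟨D + 1, by ring⟩]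
      exact Finset.single_le_sum (f := fun i => x i ^ (2 * D + 2))
        (fun i _ => Even.pow_nonneg ⟨D + 1, by ring⟩ _) (Finset.mem_univ i)
    have h3 : MvPolynomial.eval x f ^ 2 ≤ (C * ‖x‖ ^ D) ^ 2 := by
      rw [← sq_abs]
      exact pow_le_pow_left₀ (abs_nonneg _) (hC x hx1) 2
    have h4 : ε * ‖x‖ ^ (2 * D + 2) < (C * ‖x‖ ^ D) ^ 2 := by
      have := mul_le_mul_of_nonneg_left h2 hε.le
      linarith
    have h5 : (ε * ‖x‖ ^ 2) * (‖x‖ ^ D) ^ 2 < C ^ 2 * (‖x‖ ^ D) ^ 2 := by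
      calc _ = ε * ‖x‖ ^ (2 * D + 2) := by ring
        _ < _ := h4
        _ = _ := by ring
    have h6 : ε * ‖x‖ ^ 2 < C ^ 2 := lt_of_mul_lt_mul_right h5 (by positivity)
    have h7 : C ^ 2 / ε < ‖x‖ := by linarith
    rw [div_lt_iff₀ hε] at h7
    nlinarith
  have hK : IsCompact K := (isCompact_closedBall _ _).of_isClosed_subset hKc hKb
  have hyK : y ∈ K := ⟨fun j => mul_self_nonneg _, le_refl (MvPolynomial.eval y G)⟩
  obtain ⟨z, hzK, hzmin⟩ := hK.exists_isMinOn ⟨y, hyK⟩ hGc.continuousOn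
  have hGz : MvPolynomial.eval z G < 0 := lt_of_le_of_lt hzK.2 hGy
  have hfz : MvPolynomial.eval z f ≠ 0 := by
    intro h0
    rw [hG, h0] at hGz
    have := mul_nonneg hε.le (hnn z)
    linarith
  have hfy : MvPolynomial.eval y f ≠ 0 := by
    intro h0
    rw [h0] at hy
    have := mul_nonneg hε.le (hnn y)
    linarith
  rw [hf, map_prod, Finset.prod_ne_zero_iff] at hfz hfy
  have hpos : ∀ j, 0 < MvPolynomial.eval z (g j) * MvPolynomial.eval y (g j) := fun j =>
    lt_of_le_of_ne (hzK.1 j) (Ne.symm (mul_ne_zero (hfz j (mem_univ j)) (hfy j (mem_univ j))))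
  refine ⟨z, hpos, fun i => ?_⟩
  have hloc : IsLocalMin (fun x => MvPolynomial.eval x G) z := by
    have hnear : ∀ᶠ x in nhds z, ∀ j, 0 < MvPolynomial.eval x (g j) * MvPolynomial.eval y (g j) := by
      rw [Filter.eventually_all]
      intro j
      exact (((MvPolynomial.continuous_eval (g j)).mul continuous_const).tendsto z).eventually
        (lt_mem_nhds (hpos j))
    filter_upwards [hnear] with x hx
    by_cases hxG : MvPolynomial.eval x G ≤ MvPolynomial.eval y G
    · exact hzmin ⟨fun j => (hx j).le, hxG⟩
    · push Not at hxG
      exact hzK.2.trans hxG.le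
  have h0 := aux_crit G z i hloc
  have hpd : MvPolynomial.pderiv i (∑ j : Fin d, (MvPolynomial.X j : MvPolynomial (Fin d) ℝ) ^ (2 * D + 2))
      = ((2 * D + 2 : ℕ) : MvPolynomial (Fin d) ℝ) * MvPolynomial.X i ^ (2 * D + 1) := by
    rw [map_sum, Finset.sum_eq_single i]
    · rw [MvPolynomial.pderiv_pow, MvPolynomial.pderiv_X_self]; simp
    · intro j _ hj
      rw [MvPolynomial.pderiv_pow, MvPolynomial.pderiv_X_of_ne hj, mul_zero]
    · simp
  simp only [G, map_sub, MvPolynomial.pderiv_C_mul, hpd] at h0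
  simp only [map_mul, MvPolynomial.eval_C, map_pow, MvPolynomial.eval_X, map_natCast] at h0 ⊢
  push_cast at h0
  have hne : ε * (2 * (D:ℝ) + 2) ≠ 0 := by positivity
  rw [eq_inv_mul_iff_mul_eq₀ hne]
  linarith

lemma aux_strict {d D : ℕ} {ι : Type} [Fintype ι] (g : ι → MvPolynomial (Fin d) ℝ)
    (hD : (∏ j, g j).totalDegree ≤ D) (Y : Finset (Fin d → ℝ))
    (hne : ∀ y ∈ Y, ∀ j, MvPolynomial.eval y (g j) ≠ 0)
    (hinj : ∀ y ∈ Y, ∀ y' ∈ Y,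
      (∀ j, 0 < MvPolynomial.eval y (g j) * MvPolynomial.eval y' (g j)) → y = y') :
    Y.card ≤ (2 * D + 1) ^ d := by
  have hε : ∃ ε : ℝ, 0 < ε ∧ ∀ y ∈ Y,
      ε * ∑ i, y i ^ (2 * D + 2) < MvPolynomial.eval y (∏ j, g j) ^ 2 := by
    have h1 : ∀ᶠ ε in nhdsWithin (0:ℝ) (Set.Ioi 0), ∀ y ∈ Y,
        ε * ∑ i, y i ^ (2 * D + 2) < MvPolynomial.eval y (∏ j, g j) ^ 2 := by
      rw [Filter.eventually_all_finset]
      intro y hy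
      apply Filter.Eventually.filter_mono nhdsWithin_le_nhds
      have hc : Continuous fun ε : ℝ => ε * ∑ i, y i ^ (2 * D + 2) := by fun_prop
      refine (hc.tendsto 0).eventually (gt_mem_nhds ?_)
      have : MvPolynomial.eval y (∏ j, g j) ≠ 0 := by
        rw [map_prod]; exact Finset.prod_ne_zero_iff.2 fun j _ => hne y hy j
      rw [zero_mul]
      positivity
    obtain ⟨ε, h, hp⟩ := (h1.and self_mem_nhdsWithin).exists
    exact ⟨ε, hp, h⟩
  obtain ⟨ε, hε, hYε⟩ := hε
  have hz : ∀ y, ∃ z : Fin d → ℝ, y ∈ Y →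
      (∀ j, 0 < MvPolynomial.eval z (g j) * MvPolynomial.eval y (g j)) ∧
      ∀ i, z i ^ (2 * D + 1) = MvPolynomial.eval z
        (MvPolynomial.C (ε * (2 * D + 2))⁻¹ * MvPolynomial.pderiv i ((∏ j, g j) ^ 2)) := by
    intro y
    by_cases hy : y ∈ Y
    · obtain ⟨z, hz⟩ := aux_exists g hD ε hε y (hYε y hy)
      exact ⟨z, fun _ => hz⟩
    · exact ⟨0, fun h => absurd h hy⟩
  choose ζ hζ using hz
  have hinjζ : Set.InjOn ζ Y := by
    intro y hy y' hy' heq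
    refine hinj y hy y' hy' fun j => ?_
    have h1 := (hζ y hy).1 j
    have h2 := (hζ y' hy').1 j
    rw [← heq] at h2
    have h3 := mul_pos h1 h2
    have h4 : MvPolynomial.eval (ζ y) (g j) ≠ 0 := left_ne_zero_of_mul h1.ne'
    have h5 : 0 < MvPolynomial.eval (ζ y) (g j) ^ 2 := by positivity
    refine pos_of_mul_pos_right (a := MvPolynomial.eval (ζ y) (g j) ^ 2) ?_ h5.le
    calc 0 < _ := h3
      _ = _ := by ring
  rw [← Finset.card_image_of_injOn hinjζ]
  refine aux_bezout (fun i => MvPolynomial.C (ε * (2 * D + 2))⁻¹ *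
    MvPolynomial.pderiv i ((∏ j, g j) ^ 2)) (fun i => ?_) _ ?_
  · have h1 := MvPolynomial.totalDegree_mul (MvPolynomial.C (ε * (2 * D + 2))⁻¹)
      (MvPolynomial.pderiv i ((∏ j, g j) ^ 2))
    have h2 := aux_totalDegree_pderiv i ((∏ j, g j) ^ 2)
    have h3 := MvPolynomial.totalDegree_pow (∏ j, g j) 2
    rw [MvPolynomial.totalDegree_C] at h1
    omega
  · intro z hz i
    obtain ⟨y, hy, rfl⟩ := Finset.mem_image.1 hz
    exact (hζ y hy).2 i

lemma aux_signs {d Δ : ℕ} {ι : Type} [Fintype ι] (p : ι → MvPolynomial (Fin d) ℝ)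
    (hΔ : ∀ j, (p j).totalDegree ≤ Δ) (Y : Finset (Fin d → ℝ))
    (hinj : ∀ y ∈ Y, ∀ y' ∈ Y,
      (∀ j, Real.sign (MvPolynomial.eval y (p j)) = Real.sign (MvPolynomial.eval y' (p j))) →
        y = y') :
    Y.card ≤ (4 * (Fintype.card ι * Δ) + 1) ^ d := by
  have hδ : ∃ δ : ℝ, 0 < δ ∧ ∀ y ∈ Y, ∀ j, MvPolynomial.eval y (p j) ≠ 0 →
      δ < |MvPolynomial.eval y (p j)| := by
    have h1 : ∀ᶠ δ in nhdsWithin (0:ℝ) (Set.Ioi 0), ∀ y ∈ Y, ∀ j,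
        MvPolynomial.eval y (p j) ≠ 0 → δ < |MvPolynomial.eval y (p j)| := by
      rw [Filter.eventually_all_finset]
      intro y hy
      rw [Filter.eventually_all]
      intro j
      by_cases h0 : MvPolynomial.eval y (p j) = 0
      · simp [h0]
      · apply Filter.Eventually.filter_mono nhdsWithin_le_nhds
        filter_upwards [gt_mem_nhds (abs_pos.2 h0)] with δ h _ using h
    obtain ⟨δ, h, hp⟩ := (h1.and self_mem_nhdsWithin).exists
    exact ⟨δ, hp, h⟩
  obtain ⟨δ, hδ, hYδ⟩ := hδ
  let g : ι × Bool → MvPolynomial (Fin d) ℝ := fun a =>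
    p a.1 + MvPolynomial.C (if a.2 then δ else -δ)
  have hgt : ∀ y j, MvPolynomial.eval y (g (j, true)) = MvPolynomial.eval y (p j) + δ := by
    intro y j; simp [g]
  have hgf : ∀ y j, MvPolynomial.eval y (g (j, false)) = MvPolynomial.eval y (p j) - δ := by
    intro y j; simp [g, sub_eq_add_neg]
  have hgd : ∀ a, (g a).totalDegree ≤ Δ := fun a => by
    refine (MvPolynomial.totalDegree_add _ _).trans ?_
    rw [MvPolynomial.totalDegree_C]
    simpa using hΔ a.1
  have hcases : ∀ y ∈ Y, ∀ j, MvPolynomial.eval y (p j) = 0 ∨ δ < MvPolynomial.eval y (p j) ∨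
      MvPolynomial.eval y (p j) < -δ := by
    intro y hy j
    by_cases h0 : MvPolynomial.eval y (p j) = 0
    · exact Or.inl h0
    · have := hYδ y hy j h0
      rw [lt_abs] at this
      rcases this with h | h
      · exact Or.inr (Or.inl h)
      · exact Or.inr (Or.inr (by linarith))
  have hdeg : (∏ a, g a).totalDegree ≤ 2 * (Fintype.card ι * Δ) := by
    refine (MvPolynomial.totalDegree_finsetProd _ _).trans ?_
    refine (Finset.sum_le_card_nsmul _ _ Δ fun a _ => hgd a).trans ?_
    simp only [Finset.card_univ, Fintype.card_prod, Fintype.card_bool, smul_eq_mul]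
    apply le_of_eq; ring
  have := aux_strict g hdeg Y ?_ ?_
  · calc _ ≤ _ := this
      _ = _ := by ring
  · rintro y hy ⟨j, b⟩
    cases b
    · rw [hgf]; rcases hcases y hy j with h | h | h
      · rw [h]; linarith
      · linarith
      · intro h'; linarith
    · rw [hgt]; rcases hcases y hy j with h | h | h
      · rw [h]; intro h'; linarith
      · intro h'; linarith
      · intro h'; linarith
  · intro y hy y' hy' hpos
    refine hinj y hy y' hy' fun j => ?_
    have h1 := hpos (j, true)
    have h2 := hpos (j, false)
    rw [hgt, hgt] at h1
    rw [hgf, hgf] at h2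
    rcases hcases y hy j with h | h | h <;> rcases hcases y' hy' j with h' | h' | h'
    · rw [h, h']
    · rw [h] at h2; exfalso; nlinarith
    · rw [h] at h1; exfalso; nlinarith
    · rw [h'] at h2; exfalso; nlinarith
    · rw [Real.sign_of_pos (hδ.trans h), Real.sign_of_pos (hδ.trans h')]
    · exfalso; nlinarith
    · rw [h'] at h1; exfalso; nlinarith
    · exfalso; nlinarith
    · rw [Real.sign_of_neg (by linarith), Real.sign_of_neg (by linarith)]

/-- Lemma 4.1. If every range of `(X, 𝒮)` (with `X ⊆ ℝ^d`) is defined by a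
set of sign patterns of `s` real polynomials in `d` variables of degree at most `Δ`, then the
dual shatter function satisfies `π*_𝒮(k) ≤ (4eΔs)^d·k^d` for all `k ≥ 1`. -/
theorem stmt_14 (d s Δ : ℕ) (hd : 1 ≤ d) (hs : 1 ≤ s) (hΔ : 1 ≤ Δ)
    (X : Finset (Fin d → ℝ)) (𝒮 : Finset (Finset (Fin d → ℝ)))
    (hsemialg : ∀ S ∈ 𝒮, ∃ (p : Fin s → MvPolynomial (Fin d) ℝ) (signs : Set (Fin s → ℝ)),
      (∀ i, (p i).totalDegree ≤ Δ) ∧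
      S = X.filter fun x => (fun i => Real.sign (MvPolynomial.eval x (p i))) ∈ signs) :
    ∀ R ⊆ 𝒮, R.Nonempty →
      ((X.image fun x => R.filter fun r => x ∈ r).card : ℝ) ≤
        (4 * Real.exp 1 * Δ * s) ^ d * (R.card : ℝ) ^ d := by
  intro R hR hRne
  choose! p signs hp hS using hsemialg
  obtain ⟨Y, hYX, hYinj, hYimg⟩ := Finset.exists_subset_injOn_image_eq_of_surjOn
    (f := fun x => R.filter fun r => x ∈ r) (X : Set (Fin d → ℝ))
    (X.image fun x => R.filter fun r => x ∈ r)
    (by rw [Finset.coe_image]; exact Set.surjOn_image _ _)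
  have hcard : (X.image fun x => R.filter fun r => x ∈ r).card = Y.card := by
    rw [← hYimg, Finset.card_image_of_injOn hYinj]
  rw [hcard]
  have hmain := aux_signs (Δ := Δ) (fun a : R × Fin s => p a.1.1 a.2)
    (fun a => hp a.1.1 (hR a.1.2) a.2) Y (by
      intro y hy y' hy' h
      refine hYinj hy hy' ?_
      refine Finset.filter_congr fun r hr => ?_
      rw [hS r (hR hr), Finset.mem_filter, Finset.mem_filter]
      have : (fun i => Real.sign (MvPolynomial.eval y (p r i))) =
          fun i => Real.sign (MvPolynomial.eval y' (p r i)) := funext fun i => h (⟨r, hr⟩, i)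
      rw [this]
      have hyX : y ∈ X := hYX hy
      have hyX' : y' ∈ X := hYX hy'
      simp [hyX, hyX'])
  have hc : Fintype.card (R × Fin s) = R.card * s := by simp
  rw [hc] at hmain
  have hmain' : (Y.card : ℝ) ≤ (4 * (R.card * s * Δ) + 1) ^ d := by exact_mod_cast hmain
  refine hmain'.trans ?_
  rw [← mul_pow]
  refine pow_le_pow_left₀ (by positivity) ?_ d
  have h1 : (1:ℝ) ≤ R.card * s * Δ := by
    have : 1 ≤ R.card * s * Δ :=
      Nat.mul_pos (Nat.mul_pos hRne.card_pos hs) hΔ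
    exact_mod_cast this
  have he : (2:ℝ) ≤ Real.exp 1 := by
    have := Real.add_one_le_exp (1:ℝ); linarith
  nlinarith
end

section
/- Let d ≥ 2 and let X be a set of n points in ℝ^d. Then there exists a finite family Q of at most (d+2)·n^{1+1/d} Euclidean balls in ℝ^d with the following property: for every perfect matching M of X, if every ball in Q crosses at most κ edges of M, then every Euclidean ball B ⊆ ℝ^d crosses at most (d+2)·κ + 6·(d+1)²·n^{1−1/d} edges of M. -/
open Finset
open scoped Classical

/-- The number of edges of `M` crossed by a region `B` (an edge is crossed when it has one
endpoint inside `B` and one endpoint outside `B`). -/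
noncomputable def regionCrossCount {V : Type*} (M : Finset (Finset V)) (B : Set V) : ℕ :=
  (M.filter fun e => (∃ x ∈ e, x ∈ B) ∧ ∃ y ∈ e, y ∉ B).card


section hauss
variable {α : Type*}

noncomputable def EE (A : Finset α) (w : Finset α → ℕ) : ℕ :=
  ∑ a ∈ A, ∑ T ∈ (A.erase a).powerset, min (w T) (w (insert a T))

lemma min4 (a b c d : ℕ) : min a b + min c d ≤ min (max a c) (max b d) + min (min a c) (min b d) := by
  omega

lemma EE_insert (A : Finset α) (x : α) (hx : x ∉ A) (w : Finset α → ℕ) :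
    EE (insert x A) w ≤ EE A (fun T => max (w T) (w (insert x T)))
      + EE A (fun T => min (w T) (w (insert x T))) + ∑ T ∈ A.powerset, min (w T) (w (insert x T)) := by
  unfold EE
  rw [Finset.sum_insert hx, Finset.erase_insert hx, add_comm, ← Finset.sum_add_distrib]
  gcongr with a ha
  have hax : a ≠ x := fun h => hx (h ▸ ha)
  rw [Finset.erase_insert_of_ne hax.symm, Finset.sum_powerset_insert (by simp [hx]),
    ← Finset.sum_add_distrib, ← Finset.sum_add_distrib]
  refine Finset.sum_le_sum fun T hT => ?_
  rw [Finset.insert_comm a x T]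
  exact min4 _ _ _ _

lemma EE_le (A : Finset α) : ∀ (k : ℕ) (w : Finset α → ℕ),
    (∀ B ⊆ A, (∀ S ⊆ B, ∃ T ⊆ A, T ∩ B = S ∧ w T ≠ 0) → B.card < k) →
    EE A w + ∑ T ∈ A.powerset, w T ≤ k * ∑ T ∈ A.powerset, w T := by
  induction A using Finset.induction_on with
  | empty =>
    intro k w h
    simp only [EE, Finset.sum_empty, Finset.powerset_empty, Finset.sum_singleton, zero_add]
    by_cases h0 : w ∅ = 0
    · simp [h0]
    · have := h ∅ (by simp) (fun S hS => ⟨∅, by simp, by simpa using (Finset.subset_empty.1 hS).symm, h0⟩)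
      simp only [Finset.card_empty] at this
      nlinarith
  | insert x A hx ih =>
    intro k w h
    have h1 := ih k (fun T => max (w T) (w (insert x T))) (by
      intro B hB hs
      refine h B (hB.trans (Finset.subset_insert _ _)) fun S hS => ?_
      obtain ⟨T, hT, hTB, hw⟩ := hs S hS
      have hxB : x ∉ B := fun hh => hx (hB hh)
      by_cases h0 : w T = 0
      · refine ⟨insert x T, Finset.insert_subset_insert _ hT, ?_, ?_⟩
        · rw [Finset.insert_inter_of_notMem hxB, hTB]
        · intro h2; simp [h0, h2] at hw
      · exact ⟨T, hT.trans (Finset.subset_insert _ _), hTB, h0⟩)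
    have hE := EE_insert A x hx w
    have hsum : ∑ T ∈ (insert x A).powerset, w T =
        ∑ T ∈ A.powerset, max (w T) (w (insert x T)) + ∑ T ∈ A.powerset, min (w T) (w (insert x T)) := by
      rw [Finset.sum_powerset_insert hx, ← Finset.sum_add_distrib, ← Finset.sum_add_distrib]
      exact Finset.sum_congr rfl fun T _ => by omega
    rw [hsum]
    cases k with
    | zero =>
      have h00 : ∀ T ⊆ insert x A, w T = 0 := by
        intro T hT
        by_contra h0
        have := h ∅ (by simp) (fun S hS => ⟨T, hT, by simpa using (Finset.subset_empty.1 hS).symm, h0⟩)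
        omega
      have h2 := ih 0 (fun T => min (w T) (w (insert x T))) (by
        intro B hB hs
        obtain ⟨T, hT, -, hw⟩ := hs ∅ (by simp)
        simp [h00 T (hT.trans (Finset.subset_insert _ _))] at hw)
      have h3 : ∑ T ∈ A.powerset, min (w T) (w (insert x T)) = 0 := by omega
      omega
    | succ k =>
      have h2 := ih k (fun T => min (w T) (w (insert x T))) (by
        intro B hB hs
        have hxB : x ∉ B := fun hh => hx (hB hh)
        have := h (insert x B) (Finset.insert_subset_insert _ hB) fun S hS => by
          obtain ⟨T, hT, hTB, hw⟩ := hs (S.erase x) (by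
            intro y hy
            have := hS (Finset.mem_of_mem_erase hy)
            simp only [Finset.mem_insert] at this
            exact this.resolve_left (Finset.ne_of_mem_erase hy))
          have hxT : x ∉ T := fun hh => hx (hT hh)
          have hw1 : w T ≠ 0 := by omega
          have hw2 : w (insert x T) ≠ 0 := by omega
          by_cases hxS : x ∈ S
          · refine ⟨insert x T, Finset.insert_subset_insert _ hT, ?_, hw2⟩
            rw [← Finset.insert_inter_distrib, hTB, Finset.insert_erase hxS]
          · refine ⟨T, hT.trans (Finset.subset_insert _ _), ?_, hw1⟩
            rw [Finset.inter_insert_of_notMem hxT, hTB, Finset.erase_eq_of_notMem hxS]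
        rw [Finset.card_insert_of_notMem hxB] at this
        omega)
      nlinarith

noncomputable def GG (F : Finset (Finset α)) (A : Finset α) (a : α) : ℕ :=
  ∑ T ∈ A.powerset, min ((F.filter fun S => S ∩ A = T ∧ a ∉ S).card)
    ((F.filter fun S => S ∩ A = T ∧ a ∈ S).card)

lemma GG_sum (F : Finset (Finset α)) (A : Finset α) :
    ∑ a ∈ A, GG F (A.erase a) a = EE A (fun T => (F.filter fun S => S ∩ A = T).card) := by
  unfold GG EE
  refine Finset.sum_congr rfl fun a ha => Finset.sum_congr rfl fun T hT => ?_
  have haT : a ∉ T := fun h => by simpa using Finset.mem_powerset.1 hT h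
  have e1 : ∀ S : Finset α, (S ∩ A.erase a = T ∧ a ∉ S) ↔ S ∩ A = T := by
    intro S
    simp only [Finset.ext_iff, Finset.mem_inter, Finset.mem_erase]
    constructor
    · rintro ⟨h, h2⟩ b
      rw [← h b]
      by_cases hb : b = a
      · subst hb; simp [h2]
      · simp [hb]
    · intro h
      have h2 : a ∉ S := fun h3 => haT ((h a).1 ⟨h3, ha⟩)
      refine ⟨fun b => ?_, h2⟩
      rw [← h b]
      by_cases hb : b = a
      · subst hb; simp [h2]
      · simp [hb]
  have e2 : ∀ S : Finset α, (S ∩ A.erase a = T ∧ a ∈ S) ↔ S ∩ A = insert a T := by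
    intro S
    simp only [Finset.ext_iff, Finset.mem_inter, Finset.mem_erase, Finset.mem_insert]
    constructor
    · rintro ⟨h, h2⟩ b
      rw [← h b]
      by_cases hb : b = a
      · subst hb; simp [h2, ha]
      · simp [hb]
    · intro h
      have h2 : a ∈ S := ((h a).2 (Or.inl rfl)).1
      refine ⟨fun b => ?_, h2⟩
      by_cases hb : b = a
      · subst hb; simp [haT]
      · have := h b
        simp [hb] at this ⊢
        exact this
  simp only [e1, e2]




lemma class_bound2 (X A : Finset α) (P : Finset (Finset α)) (δ : ℝ) (T : Finset α)
    (hP : ∀ S ∈ P, S ⊆ X ∧ S ∩ A = T)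
    (hsep : ∀ S ∈ P, ∀ S' ∈ P, S ≠ S' → δ ≤ ((symmDiff S S').card : ℝ)) (hne : P.Nonempty) :
    ((P.card : ℝ) - 1) * δ ≤ 2 * ∑ a ∈ X \ A,
      (min ((P.filter fun S => a ∉ S).card) ((P.filter fun S => a ∈ S).card) : ℝ) := by
  have hb : (0 : ℝ) < P.card := by exact_mod_cast hne.card_pos
  have h1 : ∀ a, 2 * (((P.filter fun S => a ∉ S).card : ℝ) * ((P.filter fun S => a ∈ S).card)) =
      ∑ S ∈ P, ∑ S' ∈ P, if a ∈ symmDiff S S' then (1 : ℝ) else 0 := by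
    intro a
    have : ∀ S S' : Finset α, (if a ∈ symmDiff S S' then (1 : ℝ) else 0) =
        (if a ∉ S then (1 : ℝ) else 0) * (if a ∈ S' then (1 : ℝ) else 0) +
        (if a ∈ S then (1 : ℝ) else 0) * (if a ∉ S' then (1 : ℝ) else 0) := by
      intro S S'
      by_cases h : a ∈ S <;> by_cases h' : a ∈ S' <;> simp [h, h', Finset.mem_symmDiff]
    simp only [this, Finset.sum_add_distrib, ← Finset.mul_sum, ← Finset.sum_mul]
    simp only [Finset.sum_boole]
    ring
  have h2 : ∀ a, 2 * (((P.filter fun S => a ∉ S).card : ℝ) * ((P.filter fun S => a ∈ S).card)) ≤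
      2 * (P.card * (min ((P.filter fun S => a ∉ S).card) ((P.filter fun S => a ∈ S).card) : ℝ)) := by
    intro a
    have ha : ((P.filter fun S => a ∉ S).card : ℝ) ≤ P.card := by
      exact_mod_cast Finset.card_filter_le _ _
    have hb : ((P.filter fun S => a ∈ S).card : ℝ) ≤ P.card := by
      exact_mod_cast Finset.card_filter_le _ _
    have h0 : (0 : ℝ) ≤ ((P.filter fun S => a ∉ S).card : ℝ) := by positivity
    have h0' : (0 : ℝ) ≤ ((P.filter fun S => a ∈ S).card : ℝ) := by positivity
    rcases le_total ((P.filter fun S => a ∉ S).card : ℝ) ((P.filter fun S => a ∈ S).card : ℝ) with h | h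
    · rw [min_eq_left h]; nlinarith
    · rw [min_eq_right h]; nlinarith
  have h3 : ∀ S ∈ P, ∀ S' ∈ P, ∑ a ∈ X \ A, (if a ∈ symmDiff S S' then (1 : ℝ) else 0)
      = (symmDiff S S').card := by
    intro S hS S' hS'
    rw [Finset.sum_boole]
    congr 2
    ext a
    simp only [Finset.mem_filter, Finset.mem_sdiff, and_iff_right_iff_imp]
    intro ha
    have hA : a ∉ A := by
      intro haA
      have e : a ∈ S ∩ A ↔ a ∈ S' ∩ A := by rw [(hP S hS).2, (hP S' hS').2]
      simp only [Finset.mem_inter, haA, and_true] at e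
      rw [Finset.mem_symmDiff] at ha
      tauto
    rw [Finset.mem_symmDiff] at ha
    exact ⟨ha.elim (fun h => (hP S hS).1 h.1) (fun h => (hP S' hS').1 h.1), hA⟩
  have h4 : ∀ S ∈ P, ((P.card : ℝ) - 1) * δ ≤ ∑ S' ∈ P, ((symmDiff S S').card : ℝ) := by
    intro S hS
    rw [← Finset.add_sum_erase _ _ hS]
    have : ∑ S' ∈ P.erase S, δ ≤ ∑ S' ∈ P.erase S, ((symmDiff S S').card : ℝ) :=
      Finset.sum_le_sum fun S' hS' => hsep S hS S' (Finset.mem_of_mem_erase hS')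
        (Finset.ne_of_mem_erase hS').symm
    rw [Finset.sum_const, Finset.card_erase_of_mem hS, nsmul_eq_mul,
      Nat.cast_sub hne.card_pos] at this
    have h0 : (0 : ℝ) ≤ ((symmDiff S S).card : ℝ) := by positivity
    push_cast at this
    linarith
  have h5 : (P.card : ℝ) * (((P.card : ℝ) - 1) * δ) ≤ ∑ S ∈ P, ∑ S' ∈ P, ((symmDiff S S').card : ℝ) := by
    have := Finset.sum_le_sum h4
    simpa using this
  have h6 : ∑ S ∈ P, ∑ S' ∈ P, ((symmDiff S S').card : ℝ) =
      ∑ a ∈ X \ A, ∑ S ∈ P, ∑ S' ∈ P, if a ∈ symmDiff S S' then (1 : ℝ) else 0 := by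
    symm
    rw [Finset.sum_comm]
    refine Finset.sum_congr rfl fun S hS => ?_
    rw [Finset.sum_comm]
    exact Finset.sum_congr rfl fun S' hS' => (h3 S hS S' hS')
  rw [h6] at h5
  have h7 := h5.trans (Finset.sum_le_sum fun a _ => (h1 a).symm.le.trans (h2 a))
  rw [← Finset.mul_sum, ← Finset.mul_sum] at h7
  nlinarith

lemma GG_lower (X A : Finset α) (F : Finset (Finset α)) (δ : ℝ)
    (hF : ∀ S ∈ F, S ⊆ X)
    (hsep : ∀ S ∈ F, ∀ S' ∈ F, S ≠ S' → δ ≤ ((symmDiff S S').card : ℝ)) :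
    ((F.card : ℝ) - (F.image (fun S => S ∩ A)).card) * δ ≤ 2 * ∑ a ∈ X \ A, (GG F A a : ℝ) := by
  have hc : ∀ T ∈ F.image (fun S => S ∩ A), (((F.filter fun S => S ∩ A = T).card : ℝ) - 1) * δ ≤
      2 * ∑ a ∈ X \ A, (min ((F.filter fun S => S ∩ A = T ∧ a ∉ S).card)
        ((F.filter fun S => S ∩ A = T ∧ a ∈ S).card) : ℝ) := by
    intro T hT
    have := class_bound2 X A (F.filter fun S => S ∩ A = T) δ T
      (fun S hS => ⟨hF S (Finset.mem_filter.1 hS).1, (Finset.mem_filter.1 hS).2⟩)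
      (fun S hS S' hS' => hsep S (Finset.mem_filter.1 hS).1 S' (Finset.mem_filter.1 hS').1)
      (by
        obtain ⟨S, hS, rfl⟩ := Finset.mem_image.1 hT
        exact ⟨S, by simp [hS]⟩)
    simpa only [Finset.filter_filter] using this
  have h1 := Finset.sum_le_sum hc
  have h2 : ∑ T ∈ F.image (fun S => S ∩ A), ((F.filter fun S => S ∩ A = T).card : ℝ) = F.card := by
    exact_mod_cast (Finset.card_eq_sum_card_image (fun S => S ∩ A) F).symm
  rw [← Finset.sum_mul, Finset.sum_sub_distrib, h2, ← Finset.mul_sum, Finset.sum_comm] at h1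
  simp only [Finset.sum_const, nsmul_eq_mul, mul_one] at h1
  refine h1.trans ?_
  gcongr with a ha
  unfold GG
  push_cast
  refine Finset.sum_le_sum_of_subset_of_nonneg ?_ fun _ _ _ => by positivity
  intro T hT
  obtain ⟨S, hS, rfl⟩ := Finset.mem_image.1 hT
  exact Finset.mem_powerset.2 Finset.inter_subset_right

lemma double_count (X : Finset α) (m : ℕ) (g : Finset α → α → ℕ) :
    ∑ A ∈ X.powersetCard (m + 1), ∑ a ∈ A, g (A.erase a) a =
    ∑ A ∈ X.powersetCard m, ∑ a ∈ X \ A, g A a := by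
  rw [Finset.sum_sigma', Finset.sum_sigma']
  refine Finset.sum_bij' (fun p _ => ⟨p.1.erase p.2, p.2⟩) (fun p _ => ⟨insert p.2 p.1, p.2⟩) ?_ ?_ ?_ ?_ ?_
  · rintro ⟨A, a⟩ h
    simp only [Finset.mem_sigma, Finset.mem_powersetCard, Finset.mem_sdiff] at h ⊢
    refine ⟨⟨(Finset.erase_subset _ _).trans h.1.1, ?_⟩, h.1.1 h.2, by simp⟩
    rw [Finset.card_erase_of_mem h.2]; omega
  · rintro ⟨A, a⟩ h
    simp only [Finset.mem_sigma, Finset.mem_powersetCard, Finset.mem_sdiff] at h ⊢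
    refine ⟨⟨Finset.insert_subset h.2.1 h.1.1, ?_⟩, by simp⟩
    rw [Finset.card_insert_of_notMem h.2.2]; omega
  · rintro ⟨A, a⟩ h
    simp only [Finset.mem_sigma] at h
    simp [Finset.insert_erase h.2]
  · rintro ⟨A, a⟩ h
    simp only [Finset.mem_sigma, Finset.mem_sdiff] at h
    simp [Finset.erase_insert h.2.2]
  · rintro ⟨A, a⟩ h
    rfl

lemma sauer (F : Finset (Finset α)) (A : Finset α) (D : ℕ)
    (hvc : ∀ B, F.Shatters B → B.card ≤ D) :
    (F.image (fun S => S ∩ A)).card ≤ (A.card + 1) ^ D := by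
  refine (Finset.card_le_card_shatterer _).trans ?_
  have : (F.image (fun S => S ∩ A)).shatterer ⊆ (Finset.range (D + 1)).biUnion fun i => A.powersetCard i := by
    intro B hB
    rw [Finset.mem_shatterer] at hB
    have hBA : B ⊆ A := by
      obtain ⟨t, ht, hBt⟩ := hB.exists_superset
      obtain ⟨S, hS, rfl⟩ := Finset.mem_image.1 ht
      exact hBt.trans Finset.inter_subset_right
    have hBF : F.Shatters B := by
      intro t ht
      obtain ⟨u, hu, h⟩ := hB ht
      obtain ⟨S, hS, rfl⟩ := Finset.mem_image.1 hu
      refine ⟨S, hS, ?_⟩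
      rw [← h, Finset.inter_comm S A, ← Finset.inter_assoc, Finset.inter_eq_left.2 hBA]
    simp only [Finset.mem_biUnion, Finset.mem_range, Finset.mem_powersetCard]
    exact ⟨B.card, Nat.lt_succ_of_le (hvc B hBF), hBA, rfl⟩
  refine (Finset.card_le_card this).trans (Finset.card_biUnion_le.trans ?_)
  rw [add_pow]
  refine Finset.sum_le_sum fun i hi => ?_
  rw [Finset.card_powersetCard]
  have h1 : 0 < D.choose i := Nat.choose_pos (by simpa [Nat.lt_succ_iff] using hi)
  calc A.card.choose i ≤ A.card ^ i := Nat.choose_le_pow _ _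
    _ ≤ A.card ^ i * 1 ^ (D - i) * (D.choose i) := by
      simp only [one_pow, mul_one]; exact Nat.le_mul_of_pos_right _ h1

lemma upper (F : Finset (Finset α)) (A : Finset α) (D : ℕ)
    (hvc : ∀ B, F.Shatters B → B.card ≤ D) :
    ∑ a ∈ A, GG F (A.erase a) a ≤ D * F.card := by
  rw [GG_sum]
  have h := EE_le A (D + 1) (fun T => (F.filter fun S => S ∩ A = T).card) (by
    intro B hB hs
    refine Nat.lt_succ_of_le (hvc B fun t ht => ?_)
    obtain ⟨T, hT, h1, h2⟩ := hs t ht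
    obtain ⟨S, hS⟩ := Finset.card_ne_zero.1 h2
    rw [Finset.mem_filter] at hS
    refine ⟨S, hS.1, ?_⟩
    rw [← h1, ← hS.2, Finset.inter_assoc, Finset.inter_eq_right.2 hB, Finset.inter_comm])
  have h2 : ∑ T ∈ A.powerset, (F.filter fun S => S ∩ A = T).card = F.card :=
    (Finset.card_eq_sum_card_fiberwise fun S _ => Finset.mem_coe.2 (Finset.mem_powerset.2 Finset.inter_subset_right)).symm
  rw [h2] at h
  linarith

/-- Haussler packing, raw form. -/
lemma packing (X : Finset α) (F : Finset (Finset α)) (δ : ℝ) (D m : ℕ) (hδ : 0 ≤ δ)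
    (hF : ∀ S ∈ F, S ⊆ X)
    (hsep : ∀ S ∈ F, ∀ S' ∈ F, S ≠ S' → δ ≤ ((symmDiff S S').card : ℝ))
    (hvc : ∀ B, F.Shatters B → B.card ≤ D) (hD : 0 < D)
    (hm : m ≤ X.card) (hX : 0 < X.card) (hs : 4 * D * X.card ≤ δ * (m + 1)) :
    (F.card : ℝ) ≤ 2 * (m + 1) ^ D := by
  have h1 : ∀ A ∈ X.powersetCard m, ((F.card : ℝ) - (m + 1) ^ D) * δ ≤
      2 * ∑ a ∈ X \ A, (GG F A a : ℝ) := by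
    intro A hA
    refine le_trans ?_ (GG_lower X A F δ hF hsep)
    have h := sauer F A D hvc
    rw [(Finset.mem_powersetCard.1 hA).2] at h
    have h' : ((F.image (fun S => S ∩ A)).card : ℝ) ≤ (m + 1) ^ D := by exact_mod_cast h
    gcongr
  have h2 := Finset.sum_le_sum h1
  rw [Finset.sum_const, Finset.card_powersetCard, nsmul_eq_mul] at h2
  have h3 : ∑ A ∈ X.powersetCard m, ∑ a ∈ X \ A, GG F A a ≤
      X.card.choose (m + 1) * (D * F.card) := by
    rw [← double_count]
    refine (Finset.sum_le_sum fun A _ => upper F A D hvc).trans ?_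
    rw [Finset.sum_const, Finset.card_powersetCard, smul_eq_mul]
  have h3' : ∑ A ∈ X.powersetCard m, ∑ a ∈ X \ A, (GG F A a : ℝ) ≤
      X.card.choose (m + 1) * (D * F.card) := by exact_mod_cast h3
  have h4 : (X.card.choose (m + 1) : ℝ) * (m + 1) ≤ X.card.choose m * X.card := by
    have := Nat.choose_succ_right_eq X.card m
    have h5 : X.card.choose (m + 1) * (m + 1) ≤ X.card.choose m * X.card := by
      rw [this]; exact Nat.mul_le_mul_left _ (Nat.sub_le _ _)
    exact_mod_cast h5
  have hc : (0 : ℝ) < X.card.choose m := by exact_mod_cast Nat.choose_pos hm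
  have hn : (0 : ℝ) < X.card := by exact_mod_cast hX
  have hD' : (0 : ℝ) < D := by exact_mod_cast hD
  by_contra hcon
  push Not at hcon
  set f : ℝ := (F.card : ℝ)
  set C : ℝ := ((m : ℝ) + 1) ^ D
  have hC : 0 ≤ C := by positivity
  have hfC : 0 ≤ f - C := by linarith
  have h6 : (X.card.choose m : ℝ) * ((f - C) * (δ * (m + 1))) ≤ X.card.choose m * (2 * X.card * (D * f)) := by
    calc (X.card.choose m : ℝ) * ((f - C) * (δ * (m + 1)))
        = (X.card.choose m * ((f - C) * δ)) * (m + 1) := by ring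
      _ ≤ (2 * (X.card.choose (m + 1) * (D * f))) * (m + 1) := by
          rw [← Finset.mul_sum] at h2
          refine mul_le_mul_of_nonneg_right ?_ (by positivity)
          linarith
      _ = 2 * (D * f) * (X.card.choose (m + 1) * (m + 1)) := by ring
      _ ≤ 2 * (D * f) * (X.card.choose m * X.card) := by gcongr
      _ = _ := by ring
  have h7 := le_of_mul_le_mul_left h6 hc
  have h8 : (f - C) * (4 * D * X.card) ≤ (f - C) * (δ * (m + 1)) := by gcongr
  have h9 : (D * X.card : ℝ) * (4 * (f - C)) ≤ (D * X.card : ℝ) * (2 * f) := by nlinarith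
  have h10 := le_of_mul_le_mul_left h9 (by positivity)
  linarith
end hauss

lemma vc_balls {d : ℕ} (X : Finset (EuclideanSpace ℝ (Fin d)))
    (F : Finset (Finset (EuclideanSpace ℝ (Fin d))))
    (hF : ∀ S ∈ F, ∃ (c : EuclideanSpace ℝ (Fin d)) (r : ℝ), 0 ≤ r ∧
      S = X.filter fun x => x ∈ Metric.closedBall c r)
    (B : Finset (EuclideanSpace ℝ (Fin d))) (hB : F.Shatters B) : B.card ≤ d + 1 := by
  by_contra hcon
  have hna : ¬ AffineIndependent ℝ (Subtype.val : B → EuclideanSpace ℝ (Fin d)) := by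
    intro h
    have := h.card_le_finrank_succ
    have h2 := Submodule.finrank_le (vectorSpan ℝ (Set.range (Subtype.val : B → EuclideanSpace ℝ (Fin d))))
    rw [finrank_euclideanSpace_fin] at h2
    simp only [Fintype.card_coe] at this
    omega
  obtain ⟨I, p, hp1, hp2⟩ := Convex.radon_partition hna
  have hBX : B ⊆ X := by
    obtain ⟨u, hu, h⟩ := hB.exists_superset
    obtain ⟨c, r, -, rfl⟩ := hF u hu
    exact h.trans (Finset.filter_subset _ _)
  obtain ⟨u1, hu1, h1⟩ := hB (Finset.filter_subset (fun x => x ∈ Subtype.val '' I) B)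
  obtain ⟨u2, hu2, h2⟩ := hB (Finset.filter_subset (fun x => ¬ x ∈ Subtype.val '' I) B)
  obtain ⟨c1, r1, hr1, rfl⟩ := hF u1 hu1
  obtain ⟨c2, r2, hr2, rfl⟩ := hF u2 hu2
  have key : ∀ x c : EuclideanSpace ℝ (Fin d), ∀ r : ℝ, 0 ≤ r →
      (dist x c ≤ r ↔ ‖x‖ ^ 2 - 2 * inner ℝ c x + ‖c‖ ^ 2 ≤ r ^ 2) := by
    intro x c r hr
    rw [dist_eq_norm, real_inner_comm, ← norm_sub_sq_real]
    exact (sq_le_sq₀ (norm_nonneg _) hr).symm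
  set K : ℝ := ‖c2‖ ^ 2 - r2 ^ 2 - ‖c1‖ ^ 2 + r1 ^ 2 with hK
  have hlin : IsLinearMap ℝ (fun x : EuclideanSpace ℝ (Fin d) => 2 * inner ℝ (c2 - c1) x) := by
    constructor
    · intro x y; rw [inner_add_right]; ring
    · intro a x; rw [inner_smul_right, smul_eq_mul]; ring
  have A1 : ∀ b : B, (dist b.1 c1 ≤ r1 ↔ b ∈ I) := by
    intro b
    have := Finset.ext_iff.1 h1 b.1
    simpa [hBX b.2] using this
  have A2 : ∀ b : B, (dist b.1 c2 ≤ r2 ↔ b ∉ I) := by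
    intro b
    have := Finset.ext_iff.1 h2 b.1
    simpa [hBX b.2] using this
  have g1 : convexHull ℝ (Subtype.val '' I) ⊆
      {x : EuclideanSpace ℝ (Fin d) | 2 * inner ℝ (c2 - c1) x < K} := by
    refine convexHull_min ?_ (convex_halfSpace_lt hlin K)
    rintro _ ⟨b, hb, rfl⟩
    have e1 := (A1 b).2 hb
    have e2 : ¬ dist b.1 c2 ≤ r2 := fun h => (A2 b).1 h hb
    rw [key _ _ _ hr1] at e1
    rw [key _ _ _ hr2] at e2
    simp only [Set.mem_ofPred_eq, inner_sub_left]
    linarith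
  have g2 : convexHull ℝ (Subtype.val '' Iᶜ) ⊆
      {x : EuclideanSpace ℝ (Fin d) | K < 2 * inner ℝ (c2 - c1) x} := by
    refine convexHull_min ?_ (convex_halfSpace_gt hlin K)
    rintro _ ⟨b, hb, rfl⟩
    have e1 : ¬ dist b.1 c1 ≤ r1 := fun h => hb ((A1 b).1 h)
    have e2 := (A2 b).2 hb
    rw [key _ _ _ hr1] at e1
    rw [key _ _ _ hr2] at e2
    simp only [Set.mem_ofPred_eq, inner_sub_left]
    linarith
  have q1 : 2 * inner ℝ (c2 - c1) p < K := g1 hp1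
  have q2 : K < 2 * inner ℝ (c2 - c1) p := g2 hp2
  exact lt_asymm q1 q2

lemma card_le_of_disj {V : Type*} (M : Finset (Finset V))
    (hM : (M : Set (Finset V)).PairwiseDisjoint id) (Y : Finset V)
    (h : ∀ e ∈ M, ∃ x ∈ e, x ∈ Y) : M.card ≤ Y.card := by
  rcases isEmpty_or_nonempty V with hV | hV
  · have : M = ∅ := Finset.eq_empty_of_forall_notMem fun e he => by
      obtain ⟨x, -⟩ := h e he
      exact hV.elim x
    simp [this]
  choose! f hf using h
  refine Finset.card_le_card_of_injOn f (fun e he => (hf e he).2) ?_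
  intro e he e' he' hee
  by_contra hne
  have := hM he he' hne
  exact (Finset.disjoint_left.1 this) (hf e he).1 (hee ▸ (hf e' he').1)

lemma cross_le_card {V : Type*} [DecidableEq V] (X : Finset V) (M : Finset (Finset V))
    (hM : IsPerfectMatching X M) (B : Set V) : regionCrossCount M B ≤ X.card := by
  unfold regionCrossCount
  refine card_le_of_disj _ (hM.2.1.subset (Finset.coe_subset.2 (Finset.filter_subset _ _))) X ?_
  intro e he
  rw [Finset.mem_filter] at he
  obtain ⟨x, hx, -⟩ := he.2.1
  refine ⟨x, hx, ?_⟩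
  rw [← hM.2.2.1]
  exact Finset.mem_biUnion.2 ⟨e, he.1, hx⟩

lemma cross_le {V : Type*} [DecidableEq V] (X : Finset V) (M : Finset (Finset V))
    (hM : IsPerfectMatching X M) (B B' : Set V) :
    regionCrossCount M B ≤ regionCrossCount M B' +
      (symmDiff (X.filter fun x => x ∈ B) (X.filter fun x => x ∈ B')).card := by
  set Y := symmDiff (X.filter fun x => x ∈ B) (X.filter fun x => x ∈ B') with hY
  have hX : ∀ e ∈ M, ∀ x ∈ e, x ∈ X := by
    intro e he x hx
    rw [← hM.2.2.1]
    exact Finset.mem_biUnion.2 ⟨e, he, hx⟩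
  have hYm : ∀ x ∈ X, x ∉ Y → (x ∈ B ↔ x ∈ B') := by
    intro x hx hxY
    simp only [hY, Finset.mem_symmDiff, Finset.mem_filter, hx, true_and] at hxY
    tauto
  have h1 : (M.filter fun e => ∃ x ∈ e, x ∈ Y).card ≤ Y.card := by
    refine card_le_of_disj _ (hM.2.1.subset (Finset.coe_subset.2 (Finset.filter_subset _ _))) Y ?_
    intro e he
    exact (Finset.mem_filter.1 he).2
  unfold regionCrossCount
  refine le_trans ?_ (Nat.add_le_add_left h1 _)
  refine le_trans (Finset.card_le_card ?_) (Finset.card_union_le _ _)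
  intro e he
  rw [Finset.mem_filter] at he
  rw [Finset.mem_union, Finset.mem_filter, Finset.mem_filter]
  by_cases h : ∃ x ∈ e, x ∈ Y
  · exact Or.inr ⟨he.1, h⟩
  · left
    push Not at h
    obtain ⟨hm, ⟨x, hx, hxB⟩, y, hy, hyB⟩ := he
    exact ⟨hm, ⟨x, hx, (hYm x (hX e hm x hx) (h x hx)).1 hxB⟩, y, hy,
      fun hh => hyB ((hYm y (hX e hm y hy) (h y hy)).2 hh)⟩

lemma exists_max_sep {V : Type*} (𝒯 : Finset (Finset V)) (δ : ℝ) (hδ : 0 ≤ δ) :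
    ∃ F ⊆ 𝒯, (∀ S ∈ F, ∀ S' ∈ F, S ≠ S' → δ ≤ ((symmDiff S S').card : ℝ)) ∧
      ∀ T ∈ 𝒯, ∃ S ∈ F, ((symmDiff T S).card : ℝ) ≤ δ := by
  obtain ⟨F, hF, hmax⟩ := Finset.exists_max_image
    (𝒯.powerset.filter fun F => ∀ S ∈ F, ∀ S' ∈ F, S ≠ S' → δ ≤ ((symmDiff S S').card : ℝ))
    Finset.card ⟨∅, by simp⟩
  rw [Finset.mem_filter, Finset.mem_powerset] at hF
  refine ⟨F, hF.1, hF.2, fun T hT => ?_⟩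
  by_contra hcon
  push Not at hcon
  have hTF : T ∉ F := fun h => by
    have := hcon T h
    simp at this
    linarith
  have := hmax (insert T F) (by
    rw [Finset.mem_filter, Finset.mem_powerset]
    refine ⟨Finset.insert_subset hT hF.1, ?_⟩
    intro S hS S' hS' hne
    rw [Finset.mem_insert] at hS hS'
    rcases hS with rfl | hS <;> rcases hS' with rfl | hS'
    · exact absurd rfl hne
    · exact (hcon S' hS').le
    · rw [symmDiff_comm]; exact (hcon S hS).le
    · exact hF.2 S hS S' hS' hne)
  rw [Finset.card_insert_of_notMem hTF] at this
  omega

/-- Lemma 4.3, a test-set lemma for balls. For any `n`-point set `X ⊆ ℝ^d`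
(`d ≥ 2`) there is a family `Q` of at most `(d+2)·n^{1+1/d}` balls (given by center–radius
pairs) such that any perfect matching of `X` crossed at most `κ` times by every ball of `Q` is
crossed at most `(d+2)·κ + 6·(d+1)²·n^{1−1/d}` times by every Euclidean ball. -/
theorem stmt_15 (d : ℕ) (hd : 2 ≤ d) (X : Finset (EuclideanSpace ℝ (Fin d))) :
    ∃ Q : Finset (EuclideanSpace ℝ (Fin d) × ℝ),
      (Q.card : ℝ) ≤ ((d : ℝ) + 2) * (X.card : ℝ) ^ (1 + 1 / (d : ℝ)) ∧
      ∀ M : Finset (Finset (EuclideanSpace ℝ (Fin d))), IsPerfectMatching X M →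
        ∀ κ : ℕ, (∀ b ∈ Q, regionCrossCount M (Metric.closedBall b.1 b.2) ≤ κ) →
          ∀ (ctr : EuclideanSpace ℝ (Fin d)) (r : ℝ), 0 ≤ r →
            (regionCrossCount M (Metric.closedBall ctr r) : ℝ) ≤
              ((d : ℝ) + 2) * κ + 6 * ((d : ℝ) + 1) ^ 2 * (X.card : ℝ) ^ (1 - 1 / (d : ℝ)) := by
  have hdR : (2 : ℝ) ≤ d := by exact_mod_cast hd
  set δ : ℝ := 6 * ((d : ℝ) + 1) ^ 2 * (X.card : ℝ) ^ (1 - 1 / (d : ℝ)) with hδdef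
  have hδ : 0 ≤ δ := by positivity
  by_cases htriv : (X.card : ℝ) ≤ δ
  · refine ⟨∅, by simp; positivity, fun M hM κ _ c r _ => ?_⟩
    have h : (regionCrossCount M (Metric.closedBall c r) : ℝ) ≤ X.card := by
      exact_mod_cast cross_le_card X M hM _
    have : (0 : ℝ) ≤ ((d : ℝ) + 2) * κ := by positivity
    linarith
  push Not at htriv
  have hn : (0 : ℝ) < X.card := lt_of_le_of_lt hδ htriv
  have hn1 : (1 : ℝ) ≤ X.card := by
    have : 0 < X.card := by exact_mod_cast hn
    exact_mod_cast this
  set n : ℝ := (X.card : ℝ) with hndef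
  set y : ℝ := n ^ (1 / (d : ℝ)) with hy
  have hy0 : 0 < y := by positivity
  have hyδ : n * (6 * ((d : ℝ) + 1) ^ 2) = δ * y := by
    rw [hδdef, hy, mul_assoc _ (n ^ _), ← Real.rpow_add hn]
    simp; ring
  have hy6 : 6 * ((d : ℝ) + 1) ^ 2 < y := by
    have h : n * (6 * ((d : ℝ) + 1) ^ 2) < n * y := by rw [hyδ]; gcongr
    exact lt_of_mul_lt_mul_left h hn.le
  have hyn : y ≤ n := by
    have : n ^ (1 / (d : ℝ)) ≤ n ^ (1 : ℝ) :=
      Real.rpow_le_rpow_of_exponent_le hn1 (by rw [div_le_one (by positivity)]; linarith)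
    rwa [Real.rpow_one] at this
  have hyD : y ^ (d + 1) = n ^ (1 + 1 / (d : ℝ)) := by
    rw [hy, ← Real.rpow_natCast, ← Real.rpow_mul hn.le]
    congr 1
    push_cast
    field_simp
  have hδ0 : 0 < δ := by
    have : 0 < δ * y := by rw [← hyδ]; positivity
    exact pos_of_mul_pos_left this hy0.le
  set u : ℝ := 2 * y / (3 * ((d : ℝ) + 1)) with hu
  have hu0 : 0 ≤ u := by positivity
  set m : ℕ := ⌊u⌋₊ with hm
  have hmu : (m : ℝ) ≤ u := Nat.floor_le hu0
  have hum : u < m + 1 := Nat.lt_floor_add_one u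
  have hu9 : u ≤ 2 * y / 9 := by
    rw [hu]
    gcongr
    linarith
  have hy54 : 54 < y := by nlinarith
  set 𝒯 : Finset (Finset (EuclideanSpace ℝ (Fin d))) :=
    X.powerset.filter fun S => ∃ (c : EuclideanSpace ℝ (Fin d)) (r : ℝ), 0 ≤ r ∧
      S = X.filter fun x => x ∈ Metric.closedBall c r with h𝒯
  obtain ⟨F, hF𝒯, hsep, hcov⟩ := exists_max_sep 𝒯 δ hδ
  have hball : ∀ S ∈ F, ∃ (c : EuclideanSpace ℝ (Fin d)) (r : ℝ), 0 ≤ r ∧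
      S = X.filter fun x => x ∈ Metric.closedBall c r := fun S hS =>
    (Finset.mem_filter.1 (hF𝒯 hS)).2
  have hpack := packing X F δ (d + 1) m hδ
    (fun S hS => Finset.mem_powerset.1 (Finset.mem_filter.1 (hF𝒯 hS)).1) hsep
    (fun B hB => vc_balls X F hball B (by convert hB)) (by omega)
    (by
      have : (m : ℝ) ≤ X.card := by linarith
      exact_mod_cast this)
    (by rw [hndef] at hn; exact_mod_cast hn)
    (by
      have h1 : δ * u ≤ δ * (m + 1) := by gcongr
      refine le_trans (le_of_eq ?_) h1
      rw [hu, mul_div_assoc', mul_left_comm, ← hyδ]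
      push_cast
      field_simp
      ring)
  choose! c r hr hS using hball
  refine ⟨F.image fun S => (c S, r S), ?_, ?_⟩
  · have h1 : ((F.image fun S => (c S, r S)).card : ℝ) ≤ F.card := by
      exact_mod_cast Finset.card_image_le
    refine h1.trans (hpack.trans ?_)
    rw [← hyD]
    have h2 : ((m : ℝ) + 1) ^ (d + 1) ≤ y ^ (d + 1) := by gcongr; linarith
    have h3 : 0 ≤ y ^ (d + 1) := by positivity
    nlinarith
  · intro M hM κ hκ ctr ρ hρ
    obtain ⟨S, hSF, hSδ⟩ := hcov (X.filter fun x => x ∈ Metric.closedBall ctr ρ) (by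
      rw [h𝒯, Finset.mem_filter]
      exact ⟨Finset.mem_powerset.2 (Finset.filter_subset _ _), ctr, ρ, hρ, rfl⟩)
    have h1 := hκ _ (Finset.mem_image_of_mem (fun S => (c S, r S)) hSF)
    have h2 := cross_le X M hM (Metric.closedBall ctr ρ) (Metric.closedBall (c S) (r S))
    rw [← hS S hSF] at h2
    have h3 : (regionCrossCount M (Metric.closedBall ctr ρ) : ℝ) ≤ κ +
        ((symmDiff (X.filter fun x => x ∈ Metric.closedBall ctr ρ) S).card : ℝ) := by
      exact_mod_cast h2.trans (Nat.add_le_add_right h1 _)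
    have h5 : ((symmDiff (X.filter fun x => x ∈ Metric.closedBall ctr ρ) S).card : ℝ) ≤ δ := by
      convert hSδ
    have h4 : (0 : ℝ) ≤ κ := by positivity
    nlinarith
end

section
/- For every integer d ≥ 2 there exists a constant C = C(d) such that for every set X of n ≥ 2 points in ℝ^d there exists a perfect matching of X whose crossing number with respect to every half-space in ℝ^d is at most ( 6d² + 12e(d+1) / ((1−1/d)²·ln 2) )·n^{1−1/d} + C·ln(dn)·ln n. -/
open Finset
open scoped Classical RealInnerProductSpace

/-! ### One-inclusion graph -/

noncomputable def sh_edges {α : Type*} (A : Finset (Finset α)) (i : α) : Finset (Finset α) :=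
  A.filter fun S => i ∉ S ∧ insert i S ∈ A

lemma sh_edges_split {α : Type*} (A : Finset (Finset α)) (a i : α) (h : i ≠ a) :
    (sh_edges A i).card = (sh_edges (A.nonMemberSubfamily a) i).card +
      (sh_edges (A.memberSubfamily a) i).card := by
  rw [← card_memberSubfamily_add_card_nonMemberSubfamily a (sh_edges A i), add_comm]
  congr 2
  · ext S
    simp only [sh_edges, mem_nonMemberSubfamily, mem_filter, Finset.mem_insert]
    grind
  · ext S
    simp only [sh_edges, mem_memberSubfamily, mem_filter, Finset.mem_insert]
    rw [Finset.insert_comm]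
    grind

lemma sh_edges_union_inter {α : Type*} (A B : Finset (Finset α)) (i : α) :
    (sh_edges A i).card + (sh_edges B i).card ≤
      (sh_edges (A ∪ B) i).card + (sh_edges (A ∩ B) i).card := by
  rw [← card_union_add_card_inter]
  gcongr
  · intro S
    simp only [sh_edges, mem_union, mem_filter]
    grind
  · intro S
    simp only [sh_edges, mem_inter, mem_filter]
    grind

lemma edges_le {α : Type*} (U : Finset α) : ∀ (A : Finset (Finset α)) (d : ℕ),
    (∀ T, A.Shatters T → T.card ≤ d) → ∑ i ∈ U, (sh_edges A i).card ≤ d * A.card := by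
  induction U using Finset.induction_on with
  | empty => intro A d _; simp
  | insert a U ha ih =>
    intro A d hA
    rw [Finset.sum_insert ha]
    set A0 := A.nonMemberSubfamily a with hA0
    set A1 := A.memberSubfamily a with hA1
    have hcard : A.card = (A0 ∪ A1).card + (A0 ∩ A1).card := by
      rw [card_union_add_card_inter, ← card_memberSubfamily_add_card_nonMemberSubfamily a A,
        add_comm]
    have h0 : (sh_edges A a).card = (A0 ∩ A1).card := by
      congr 1
      ext S
      simp only [sh_edges, hA0, hA1, mem_filter, mem_inter, mem_nonMemberSubfamily,
        mem_memberSubfamily]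
      grind
    have hnot : ∀ S ∈ A0 ∪ A1, a ∉ S := by
      intro S
      simp only [hA0, hA1, mem_union, mem_nonMemberSubfamily, mem_memberSubfamily]
      grind
    have hnotT : ∀ B : Finset (Finset α), (∀ S ∈ B, a ∉ S) → ∀ T, B.Shatters T → a ∉ T := by
      intro B hB T hT haT
      obtain ⟨S, hS, hTS⟩ := hT (Finset.Subset.refl T)
      have : a ∈ T ∩ S := by rw [hTS]; exact haT
      exact hB S hS (Finset.mem_inter.1 this).2
    have h1 := ih (A0 ∪ A1) d (by
      intro T hT
      have haT := hnotT _ hnot T hT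
      apply hA
      intro t ht
      obtain ⟨S, hS, hTS⟩ := hT ht
      simp only [hA0, hA1, mem_union, mem_nonMemberSubfamily, mem_memberSubfamily] at hS
      rcases hS with hS | hS
      · exact ⟨S, hS.1, hTS⟩
      · exact ⟨insert a S, hS.1, by rw [Finset.inter_insert_of_notMem haT, hTS]⟩)
    have hsh : ∀ T, (A0 ∩ A1).Shatters T → T.card + 1 ≤ d := by
      intro T hT
      have haT := hnotT _ (fun S hS => hnot S (Finset.mem_union_left _ (Finset.mem_inter.1 hS).1))
        T hT
      rw [← Finset.card_insert_of_notMem haT]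
      apply hA
      intro t ht
      obtain ⟨S, hS, hTS⟩ := hT (t := t.erase a) (by
        intro x hx
        have := ht (Finset.mem_of_mem_erase hx)
        grind)
      simp only [hA0, hA1, mem_inter, mem_nonMemberSubfamily, mem_memberSubfamily] at hS
      by_cases hat : a ∈ t
      · refine ⟨insert a S, hS.2.1, ?_⟩
        rw [← Finset.insert_inter_distrib, hTS, Finset.insert_erase hat]
      · refine ⟨S, hS.1.1, ?_⟩
        rw [Finset.insert_inter_of_notMem hS.1.2, hTS, Finset.erase_eq_of_notMem hat]
    have h2 := ih (A0 ∩ A1) (d - 1) (fun T hT => by have := hsh T hT; omega)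
    have h3 : ∑ i ∈ U, (sh_edges A i).card ≤
        ∑ i ∈ U, (sh_edges (A0 ∪ A1) i).card + ∑ i ∈ U, (sh_edges (A0 ∩ A1) i).card := by
      rw [← Finset.sum_add_distrib]
      refine Finset.sum_le_sum fun i hi => ?_
      rw [sh_edges_split A a i (by rintro rfl; exact ha hi)]
      exact sh_edges_union_inter _ _ _
    have h4 : (d - 1) * (A0 ∩ A1).card + (A0 ∩ A1).card ≤ d * (A0 ∩ A1).card := by
      rcases (A0 ∩ A1).eq_empty_or_nonempty with he | he
      · simp [he]
      · have := hsh ∅ (by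
          intro t ht
          obtain ⟨S, hS⟩ := he
          refine ⟨S, hS, ?_⟩
          rw [Finset.subset_empty.1 ht]; simp)
        obtain ⟨e, rfl⟩ : ∃ e, d = e + 1 := ⟨d - 1, by simp at this; omega⟩
        simp [add_mul]
    rw [h0, hcard, mul_add]
    omega

lemma edges_weighted {α : Type*} [Fintype α] (w : Finset α → ℕ) (d : ℕ)
    (hA : ∀ T, (univ.filter fun S => 0 < w S).Shatters T → T.card ≤ d) :
    ∑ i : α, ∑ S : Finset α, (if i ∈ S then 0 else min (w S) (w (insert i S))) ≤
      d * ∑ S : Finset α, w S := by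
  set n := ∑ S : Finset α, w S with hn
  have hw : ∀ S, w S ≤ n := fun S => Finset.single_le_sum (f := w) (fun _ _ => Nat.zero_le _)
    (Finset.mem_univ S)
  let F : ℕ → Finset (Finset α) := fun t => univ.filter fun S => t < w S
  have hF : ∀ t, ∀ T, (F t).Shatters T → T.card ≤ d := by
    intro t T hT
    apply hA
    refine hT.mono_left ?_
    intro S
    simp only [F, mem_filter]
    grind
  have h1 : ∀ S, w S = ∑ t ∈ range n, if S ∈ F t then 1 else 0 := by
    intro S
    rw [← Finset.card_filter]
    have : (range n).filter (fun t => S ∈ F t) = range (w S) := by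
      ext t
      have := hw S
      simp [F]; omega
    rw [this, card_range]
  have h2 : ∀ i S, (if i ∈ S then 0 else min (w S) (w (insert i S))) =
      ∑ t ∈ range n, if S ∈ sh_edges (F t) i then 1 else 0 := by
    intro i S
    rw [← Finset.card_filter]
    by_cases hi : i ∈ S
    · simp [hi, sh_edges]
    · have : (range n).filter (fun t => S ∈ sh_edges (F t) i) =
        range (min (w S) (w (insert i S))) := by
        ext t
        have := hw S
        simp [F, sh_edges, hi]; omega
      rw [this, card_range, if_neg hi]
  have h3 : ∀ B : Finset (Finset α), (∑ S : Finset α, if S ∈ B then 1 else 0) = B.card := by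
    intro B; simp
  calc _ = ∑ i : α, ∑ t ∈ range n, ∑ S : Finset α, if S ∈ sh_edges (F t) i then 1 else 0 := by
        refine Finset.sum_congr rfl fun i _ => ?_
        rw [Finset.sum_comm]
        exact Finset.sum_congr rfl fun S _ => h2 i S
    _ = ∑ t ∈ range n, ∑ i : α, (sh_edges (F t) i).card := by
        rw [Finset.sum_comm]
        simp only [h3]
    _ ≤ ∑ t ∈ range n, d * (F t).card := Finset.sum_le_sum fun t _ => edges_le _ _ _ (hF t)
    _ = d * n := by
        rw [← Finset.mul_sum]
        congr 1
        refine Eq.symm (hn.trans ((Finset.sum_congr rfl fun S _ => h1 S).trans ?_))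
        rw [Finset.sum_comm]
        simp only [h3]

/-! ### Sauer-Shelah, crude form -/

lemma sauer_s16 {α : Type*} [Fintype α] (A : Finset (Finset α)) (d : ℕ)
    (hA : ∀ T, A.Shatters T → T.card ≤ d) : A.card ≤ (Fintype.card α + 1) ^ d := by
  have h1 : A.card ≤ ∑ k ∈ Iic A.vcDim, (Fintype.card α).choose k :=
    (card_le_card_shatterer A).trans card_shatterer_le_sum_vcDim
  have h2 : A.vcDim ≤ d := by
    unfold Finset.vcDim
    exact Finset.sup_le fun T hT => hA T (mem_shatterer.1 hT)
  refine h1.trans ?_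
  rw [add_pow]
  calc _ ≤ ∑ k ∈ range (d + 1), (Fintype.card α).choose k := by
        apply Finset.sum_le_sum_of_subset
        intro k; simp; omega
    _ ≤ _ := by
        refine Finset.sum_le_sum fun k hk => ?_
        have : 0 < d.choose k := Nat.choose_pos (by simp at hk; omega)
        have h3 := Nat.choose_le_pow (Fintype.card α) k
        simp only [one_pow, mul_one]
        exact h3.trans (Nat.le_mul_of_pos_right _ this)

/-! ### Packing -/

noncomputable def sep {V Ω : Type*} [Fintype Ω] (R : V → Ω → Prop) (x y : V) : ℕ :=
  (univ.filter fun o => ¬ (R x o ↔ R y o)).card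

noncomputable def pat {V Ω ι : Type*} [Fintype ι] (R : V → Ω → Prop) (f : ι → Ω) (x : V) :
    Finset ι := univ.filter fun i => R x (f i)

def DualVC {V Ω : Type*} (R : V → Ω → Prop) (d : ℕ) : Prop :=
  ∀ g : Fin (d + 1) → Ω, ∃ T : Finset (Fin (d + 1)), ∀ x, ¬ ∀ i, (i ∈ T ↔ R x (g i))

lemma pat_shatters {V Ω ι : Type*} [Fintype ι] (R : V → Ω → Prop) (d : ℕ) (h : DualVC R d)
    (P : Finset V) (f : ι → Ω) (T : Finset ι) (hT : (P.image (pat R f)).Shatters T) :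
    T.card ≤ d := by
  by_contra hc
  obtain ⟨T', hT', hc'⟩ := Finset.exists_subset_card_eq (show d + 1 ≤ T.card by omega)
  let e : Fin (d + 1) ↪ ι := (T'.equivFinOfCardEq hc').symm.toEmbedding.trans
    (Function.Embedding.subtype _)
  have he : ∀ i, e i ∈ T := fun i => hT' ((T'.equivFinOfCardEq hc').symm i).2
  obtain ⟨T0, hT0⟩ := h (f ∘ e)
  obtain ⟨S, hS, hTS⟩ := hT (t := T0.map e) (by
    intro x hx
    obtain ⟨i, _, rfl⟩ := Finset.mem_map.1 hx
    exact he i)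
  obtain ⟨x, _, rfl⟩ := Finset.mem_image.1 hS
  refine hT0 x fun i => ?_
  rw [← Finset.mem_map' e, ← hTS]
  simp [he, pat]

lemma class_bound {V Ω : Type*} [Fintype Ω] (R : V → Ω → Prop) (Q : Finset V) (D : ℝ)
    (hD : 0 ≤ D) (h : ∀ x ∈ Q, ∀ y ∈ Q, x ≠ y → D ≤ sep R x y) :
    D * ((Q.card : ℝ) - 1) / 2 ≤ ∑ o : Ω,
      ((min (Q.filter fun x => ¬ R x o).card (Q.filter fun x => R x o).card : ℕ) : ℝ) := by
  rcases Q.eq_empty_or_nonempty with rfl | hQ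
  · simp; linarith
  have hc : (0 : ℝ) < Q.card := by exact_mod_cast hQ.card_pos
  have h1 : D * (Q.card * ((Q.card : ℝ) - 1)) ≤ ∑ x ∈ Q, ∑ y ∈ Q, (sep R x y : ℝ) := by
    have : ∀ x ∈ Q, D * ((Q.card : ℝ) - 1) ≤ ∑ y ∈ Q, (sep R x y : ℝ) := by
      intro x hx
      rw [← Finset.add_sum_erase _ _ hx]
      have h2 : ∑ y ∈ Q.erase x, D ≤ ∑ y ∈ Q.erase x, (sep R x y : ℝ) := by
        refine Finset.sum_le_sum fun y hy => ?_
        rw [Finset.mem_erase] at hy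
        exact h x hx y hy.2 hy.1.symm
      rw [Finset.sum_const, Finset.card_erase_of_mem hx, nsmul_eq_mul,
        Nat.cast_sub hQ.card_pos] at h2
      have : (0 : ℝ) ≤ sep R x x := Nat.cast_nonneg _
      push_cast at h2
      linarith
    have := Finset.sum_le_sum this
    rw [Finset.sum_const, nsmul_eq_mul] at this
    linarith
  have h2 : ∑ x ∈ Q, ∑ y ∈ Q, (sep R x y : ℝ) = ∑ o : Ω,
      2 * (((Q.filter fun x => ¬ R x o).card : ℝ) * (Q.filter fun x => R x o).card) := by
    have e1 : ∀ x y, (sep R x y : ℝ) = ∑ o : Ω,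
        ((if R x o then 1 else 0) * (if ¬ R y o then 1 else 0) +
          (if ¬ R x o then 1 else 0) * (if R y o then 1 else 0)) := by
      intro x y
      unfold sep
      rw [Finset.card_filter]
      push_cast
      refine Finset.sum_congr rfl fun o _ => ?_
      by_cases a : R x o <;> by_cases b : R y o <;> simp [a, b]
    simp only [e1]
    have e2 : ∀ x, ∑ y ∈ Q, ∑ o : Ω,
        (((if R x o then 1 else 0) * (if ¬ R y o then 1 else 0) +
          (if ¬ R x o then 1 else 0) * (if R y o then 1 else 0) : ℝ)) = ∑ o : Ω, ∑ y ∈ Q,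
        ((if R x o then 1 else 0) * (if ¬ R y o then 1 else 0) +
          (if ¬ R x o then 1 else 0) * (if R y o then 1 else 0)) := fun x => Finset.sum_comm
    simp only [e2]
    rw [Finset.sum_comm]
    refine Finset.sum_congr rfl fun o _ => ?_
    simp only [Finset.sum_add_distrib, ← Finset.mul_sum, ← Finset.sum_mul]
    simp only [Finset.card_filter]
    push_cast
    ring
  have h3 : ∀ o : Ω, (((Q.filter fun x => ¬ R x o).card : ℝ) * (Q.filter fun x => R x o).card) ≤
      Q.card * ((min (Q.filter fun x => ¬ R x o).card (Q.filter fun x => R x o).card : ℕ) : ℝ) := by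
    intro o
    have a1 := Finset.card_filter_le Q (fun x => ¬ R x o)
    have a2 := Finset.card_filter_le Q (fun x => R x o)
    norm_cast
    rcases le_total (Q.filter fun x => ¬ R x o).card (Q.filter fun x => R x o).card with hh | hh
    · rw [min_eq_left hh, mul_comm]; gcongr
    · rw [min_eq_right hh]; gcongr
  have h4 := Finset.sum_le_sum fun o (_ : o ∈ (univ : Finset Ω)) => h3 o
  rw [h2, ← Finset.mul_sum] at h1
  rw [← Finset.mul_sum] at h4
  have h5 : (Q.card : ℝ) * (D * ((Q.card : ℝ) - 1) / 2) ≤ Q.card * ∑ o : Ω,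
      ((min (Q.filter fun x => ¬ R x o).card (Q.filter fun x => R x o).card : ℕ) : ℝ) := by
    linarith
  exact le_of_mul_le_mul_left h5 hc

noncomputable def eDir {V Ω ι : Type*} [Fintype ι] (R : V → Ω → Prop) (P : Finset V)
    (i : ι) (f : ι → Ω) : ℕ :=
  ∑ S : Finset ι, if i ∈ S then 0 else
    min (P.filter fun x => pat R f x = S).card (P.filter fun x => pat R f x = insert i S).card

lemma eDir_sum {V Ω ι : Type*} [Fintype ι] (R : V → Ω → Prop) (P : Finset V) (d : ℕ)
    (h : DualVC R d) (f : ι → Ω) : ∑ i, eDir R P i f ≤ d * P.card := by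
  have h1 := edges_weighted (fun S => (P.filter fun x => pat R f x = S).card) d (by
    intro T hT
    refine pat_shatters R d h P f T (hT.mono_left ?_)
    intro S
    simp only [mem_filter, Finset.card_pos, Finset.mem_image, Finset.mem_univ, true_and]
    rintro ⟨x, hx⟩
    exact ⟨x, (mem_filter.1 hx).1, (mem_filter.1 hx).2⟩)
  rw [← Finset.card_eq_sum_card_fiberwise (fun x _ => Finset.mem_univ _)] at h1
  exact h1

lemma eDir_avg {V Ω ι : Type*} [Fintype ι] [Fintype Ω] (R : V → Ω → Prop) (P : Finset V) (d : ℕ)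
    (h : DualVC R d) (D : ℝ) (hD : 0 ≤ D) (hP : ∀ x ∈ P, ∀ y ∈ P, x ≠ y → D ≤ sep R x y)
    (i : ι) (f : ι → Ω) :
    D * ((P.card : ℝ) - ((Fintype.card ι : ℝ) + 1) ^ d) / 2 ≤
      ∑ o : Ω, (eDir R P i (Function.update f i o) : ℝ) := by
  let u : V → Finset ι := fun x => (pat R f x).erase i
  have hu : ∀ o x, pat R (Function.update f i o) x = if R x o then insert i (u x) else u x := by
    intro o x
    ext j
    by_cases hj : j = i
    · subst hj
      by_cases hR : R x o <;> simp [pat, u, hR]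
    · by_cases hR : R x o <;> simp [pat, u, hR, hj]
  have hui : ∀ x, i ∉ u x := fun x => by simp [u]
  have e1 : ∀ o, eDir R P i (Function.update f i o) = ∑ S : Finset ι, if i ∈ S then 0 else
      min ((P.filter fun x => u x = S).filter fun x => ¬ R x o).card
        ((P.filter fun x => u x = S).filter fun x => R x o).card := by
    intro o
    unfold eDir
    refine Finset.sum_congr rfl fun S _ => ?_
    by_cases hi : i ∈ S
    · simp [hi]
    · rw [if_neg hi, if_neg hi]
      congr 2
      · ext x
        have := hui x
        simp only [mem_filter, hu]
        by_cases hR : R x o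
        · simp only [hR, if_true]
          constructor
          · rintro ⟨_, rfl⟩; simp at hi
          · simp
        · simp [hR]
      · ext x
        have := hui x
        simp only [mem_filter, hu]
        by_cases hR : R x o
        · simp only [hR, if_true, and_true]
          refine and_congr_right fun _ => ⟨fun hh => ?_, fun hh => by rw [hh]⟩
          rw [← Finset.erase_insert this, hh, Finset.erase_insert hi]
        · simp only [hR, if_false, and_false, iff_false, not_and]
          rintro _ hh
          rw [hh] at this; simp at this
  have hcl : ((P.image u).card : ℝ) ≤ ((Fintype.card ι : ℝ) + 1) ^ d := by
    have : (P.image u).card ≤ (P.image (pat R f)).card := by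
      have : P.image u = (P.image (pat R f)).image (fun S => S.erase i) := by
        rw [Finset.image_image]; rfl
      rw [this]; exact Finset.card_image_le
    have := this.trans (sauer_s16 _ d (pat_shatters R d h P f))
    exact_mod_cast this
  calc _ ≤ D * ((P.card : ℝ) - (P.image u).card) / 2 := by gcongr
    _ = ∑ S ∈ P.image u, D * (((P.filter fun x => u x = S).card : ℝ) - 1) / 2 := by
        rw [← Finset.sum_div, ← Finset.mul_sum, Finset.sum_sub_distrib]
        rw [Finset.card_eq_sum_card_image u P]
        push_cast
        simp
    _ ≤ ∑ S ∈ P.image u, ∑ o : Ω,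
        ((min ((P.filter fun x => u x = S).filter fun x => ¬ R x o).card
        ((P.filter fun x => u x = S).filter fun x => R x o).card : ℕ) : ℝ) := by
        refine Finset.sum_le_sum fun S _ => class_bound R _ D hD ?_
        intro x hx y hy
        exact hP x (mem_filter.1 hx).1 y (mem_filter.1 hy).1
    _ = ∑ o : Ω, ∑ S ∈ P.image u,
        ((min ((P.filter fun x => u x = S).filter fun x => ¬ R x o).card
        ((P.filter fun x => u x = S).filter fun x => R x o).card : ℕ) : ℝ) := Finset.sum_comm
    _ ≤ _ := by
        refine Finset.sum_le_sum fun o _ => ?_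
        rw [e1]
        push_cast
        refine le_trans (le_of_eq ?_) (Finset.sum_le_sum_of_subset_of_nonneg
          (Finset.subset_univ (P.image u)) (fun S _ _ => by positivity))
        refine Finset.sum_congr rfl fun S hS => ?_
        obtain ⟨x, _, rfl⟩ := Finset.mem_image.1 hS
        rw [if_neg (hui x)]

lemma resample {Ω ι : Type*} [Fintype ι] [Fintype Ω] (F : (ι → Ω) → ℝ) (i : ι) :
    ∑ f : ι → Ω, ∑ o : Ω, F (Function.update f i o) = Fintype.card Ω * ∑ f : ι → Ω, F f := by
  have h1 : ∑ p : (ι → Ω) × Ω, F (Function.update p.1 i p.2) = ∑ p : (ι → Ω) × Ω, F p.1 := by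
    have hinv : Function.Involutive
        (fun p : (ι → Ω) × Ω => (Function.update p.1 i p.2, p.1 i)) := by
      rintro ⟨f, o⟩; simp
    exact Equiv.sum_comp (hinv.toPerm _) (fun p : (ι → Ω) × Ω => F p.1)
  rw [Fintype.sum_prod_type, Fintype.sum_prod_type] at h1
  rw [h1]
  simp [Finset.mul_sum]

lemma packing_s16 {V Ω : Type*} (ι : Type*) [Fintype ι] [Fintype Ω] [Nonempty Ω] (R : V → Ω → Prop) (P : Finset V) (d : ℕ)
    (h : DualVC R d) (D : ℝ) (hD : 0 ≤ D) (hP : ∀ x ∈ P, ∀ y ∈ P, x ≠ y → D ≤ sep R x y) :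
    (Fintype.card ι : ℝ) * (D * ((P.card : ℝ) - ((Fintype.card ι : ℝ) + 1) ^ d)) ≤ 2 * d * P.card * Fintype.card Ω := by
  set K : ℝ := D * ((P.card : ℝ) - ((Fintype.card ι : ℝ) + 1) ^ d) with hK
  set G : ℝ := (Fintype.card (ι → Ω) : ℝ) with hG
  have hG0 : 0 < G := by rw [hG]; exact_mod_cast Fintype.card_pos
  have h1 : ∀ i : ι, G * (K / 2) ≤ Fintype.card Ω * ∑ f : ι → Ω, (eDir R P i f : ℝ) := by
    intro i
    rw [← resample]
    have := Finset.sum_le_sum fun f (_ : f ∈ (univ : Finset (ι → Ω))) =>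
      eDir_avg R P d h D hD hP i f
    simpa [hG, hK] using this
  have h2 := Finset.sum_le_sum fun i (_ : i ∈ (univ : Finset (ι))) => h1 i
  rw [← Finset.mul_sum _ _ (Fintype.card Ω : ℝ), Finset.sum_comm, Finset.sum_const, card_univ,
    nsmul_eq_mul] at h2
  have h3 : ∑ f : ι → Ω, ∑ i : ι, (eDir R P i f : ℝ) ≤ G * (d * P.card) := by
    have : ∀ f ∈ (univ : Finset (ι → Ω)), ∑ i : ι, (eDir R P i f : ℝ) ≤ d * P.card := by
      intro f _
      exact_mod_cast eDir_sum R P d h f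
    have := Finset.sum_le_sum this
    rwa [Finset.sum_const, card_univ, nsmul_eq_mul] at this
  have h4 : G * ((Fintype.card ι : ℝ) * K) ≤ G * (2 * d * P.card * Fintype.card Ω) := by
    have : (Fintype.card Ω : ℝ) * ∑ f : ι → Ω, ∑ i : ι, (eDir R P i f : ℝ) ≤
      Fintype.card Ω * (G * (d * P.card)) := by gcongr
    linarith
  exact le_of_mul_le_mul_left h4 hG0

lemma short_edge {V Ω : Type*} [Fintype Ω] (R : V → Ω → Prop) (P : Finset V) (d : ℕ)
    (hd : 2 ≤ d) (h : DualVC R d) (hP : 2 ≤ P.card) :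
    ∃ x ∈ P, ∃ y ∈ P, x ≠ y ∧
      (sep R x y : ℝ) ≤ 32 * d / (P.card : ℝ) ^ (1 / (d : ℝ)) * Fintype.card Ω := by
  by_contra hcon
  push Not at hcon
  set q : ℝ := (P.card : ℝ) ^ (1 / (d : ℝ)) with hq
  have hn : (2 : ℝ) ≤ P.card := by exact_mod_cast hP
  have hq0 : 0 < q := by positivity
  have hqd : q ^ d = P.card := by
    rw [hq, ← Real.rpow_natCast, ← Real.rpow_mul (by positivity)]
    rw [one_div_mul_cancel (by positivity), Real.rpow_one]
  obtain ⟨x0, hx0, y0, hy0, hxy⟩ := Finset.one_lt_card.1 (show 1 < P.card by omega)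
  have hsepN : (sep R x0 y0 : ℝ) ≤ Fintype.card Ω := by
    unfold sep
    exact_mod_cast Finset.card_le_univ _
  have h0 := hcon x0 hx0 y0 hy0 hxy
  set N : ℝ := (Fintype.card Ω : ℝ) with hN
  have hd' : (2 : ℝ) ≤ d := by exact_mod_cast hd
  have hN0 : 0 < N := by
    rcases (Nat.cast_nonneg (Fintype.card Ω) : (0:ℝ) ≤ _).lt_or_eq with hh | hh
    · exact hh
    · rw [hN, ← hh, mul_zero] at h0
      rw [hN, ← hh] at hsepN
      linarith
  have hne : Nonempty Ω := by
    rw [← Fintype.card_pos_iff]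
    have hN1 := hN0
    rw [hN] at hN1
    exact_mod_cast hN1
  have h5 : 32 * d / q < 1 := by
    have : 32 * d / q * N < 1 * N := by linarith
    exact lt_of_mul_lt_mul_right this hN0.le
  rw [div_lt_one hq0] at h5
  have hpk := packing_s16 (Fin ⌊q / 4⌋₊) R P d h (32 * d / q * N) (by positivity)
    (fun x hx y hy hxy => (hcon x hx y hy hxy).le)
  rw [Fintype.card_fin] at hpk
  have hs1 : ((⌊q / 4⌋₊ : ℕ) : ℝ) ≤ q / 4 := Nat.floor_le (by positivity)
  have hs2 : q / 4 < ((⌊q / 4⌋₊ : ℕ) : ℝ) + 1 := Nat.lt_floor_add_one _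
  set s : ℝ := ((⌊q / 4⌋₊ : ℕ) : ℝ) with hs
  have hs3 : q / 8 < s := by linarith
  have hs4 : 2 * (s + 1) ^ d ≤ P.card := by
    calc 2 * (s + 1) ^ d ≤ 2 ^ d * (s + 1) ^ d := by
          gcongr
          calc (2 : ℝ) = 2 ^ 1 := by norm_num
            _ ≤ 2 ^ d := pow_le_pow_right₀ (by norm_num) (by omega)
      _ = (2 * (s + 1)) ^ d := by rw [mul_pow]
      _ ≤ q ^ d := by
          gcongr
          linarith
      _ = _ := hqd
  have h6 : (P.card : ℝ) / 2 ≤ P.card - (s + 1) ^ d := by linarith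
  have h7 : q / 8 * (32 * d / q * N * (P.card / 2)) < s * (32 * d / q * N * (P.card - (s + 1) ^ d)) := by
    have : 32 * d / q * N * (P.card / 2) ≤ 32 * d / q * N * (P.card - (s + 1) ^ d) := by gcongr
    have hp : 0 < 32 * d / q * N * (P.card / 2) := by positivity
    calc _ < s * (32 * d / q * N * (P.card / 2)) := by gcongr
      _ ≤ _ := by gcongr
  have h8 : q / 8 * (32 * d / q * N * (P.card / 2)) = 2 * d * P.card * N := by
    field_simp; ring
  linarith

/-! ### Multiplicative weights -/

lemma weighted_edge {V H : Type*} [Fintype H] (R : V → H → Prop) (P : Finset V) (d : ℕ)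
    (hd : 2 ≤ d) (h : DualVC R d) (hP : 2 ≤ P.card) (w : H → ℕ) :
    ∃ x ∈ P, ∃ y ∈ P, x ≠ y ∧
      ((∑ o, if (R x o ↔ R y o) then 0 else w o : ℕ) : ℝ) ≤
        32 * d / (P.card : ℝ) ^ (1 / (d : ℝ)) * ((∑ o, w o : ℕ) : ℝ) := by
  obtain ⟨x, hx, y, hy, hxy, hs⟩ := short_edge (Ω := Σ o : H, Fin (w o)) (fun x o => R x o.1) P d hd
    (fun g => h (fun i => (g i).1)) hP
  refine ⟨x, hx, y, hy, hxy, ?_⟩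
  have e : sep (fun x (o : Σ o : H, Fin (w o)) => R x o.1) x y =
      ∑ o, if (R x o ↔ R y o) then 0 else w o := by
    unfold sep
    rw [Finset.card_filter, Fintype.sum_sigma]
    refine Finset.sum_congr rfl fun o _ => ?_
    by_cases hh : (R x o ↔ R y o) <;> simp [hh]
  rw [e] at hs
  simpa using hs

lemma rpow_step (α n : ℝ) (h0 : 0 ≤ α) (h1 : α ≤ 1) (hn : 2 ≤ n) :
    (n - 2) ^ α + 2 * α * n ^ (α - 1) ≤ n ^ α := by
  have hp : 0 < n := by linarith
  have e : n - 2 = n * (1 + (-2 / n)) := by field_simp; ring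
  have hb : -1 ≤ -2 / n := by rw [le_div_iff₀ hp]; linarith
  have := rpow_one_add_le_one_add_mul_self hb h0 h1
  rw [e, Real.mul_rpow hp.le (by linarith), Real.rpow_sub_one hp.ne']
  have h3 : n ^ α * (1 + -2 / n) ^ α ≤ n ^ α * (1 + α * (-2 / n)) := by gcongr
  have h4 : n ^ α * (1 + α * (-2 / n)) = n ^ α - 2 * α * (n ^ α / n) := by field_simp; ring
  linarith

lemma cross_insert {V : Type*} [DecidableEq V] (M : Finset (Finset V)) (x y : V) (B : Set V)
    (hM : ({x, y} : Finset V) ∉ M) :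
    regionCrossCount (insert {x, y} M) B =
      regionCrossCount M B + if (x ∈ B ↔ y ∈ B) then 0 else 1 := by
  unfold regionCrossCount
  rw [Finset.filter_insert]
  by_cases h : (x ∈ B ↔ y ∈ B)
  · rw [if_neg, if_pos h]
    · rfl
    · rintro ⟨⟨a, ha, haB⟩, b, hb, hbB⟩
      simp only [Finset.mem_insert, Finset.mem_singleton] at ha hb
      grind
  · rw [if_pos, if_neg h, Finset.card_insert_of_notMem]
    · intro hh; exact hM (Finset.mem_filter.1 hh).1
    · by_cases hx : x ∈ B
      · exact ⟨⟨x, by simp, hx⟩, y, by simp, fun hy => h (by simp [hx, hy])⟩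
      · exact ⟨⟨y, by simp, by by_contra hy; exact h (by simp [hx, hy])⟩, x, by simp, hx⟩

lemma mwu {V H : Type*} [DecidableEq V] [Fintype H] (R : V → H → Prop) (d : ℕ)
    (hd : 2 ≤ d) (h : DualVC R d) : ∀ (n : ℕ) (Y : Finset V) (w : H → ℕ), Y.card = n →
    ∃ M : Finset (Finset V), IsPerfectMatching Y M ∧
      ((∑ o, w o * 2 ^ regionCrossCount M {x | R x o} : ℕ) : ℝ) ≤
        ((∑ o, w o : ℕ) : ℝ) *
          Real.exp (16 * d / (1 - 1 / (d : ℝ)) * (n : ℝ) ^ (1 - 1 / (d : ℝ))) := by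
  intro n
  have hd' : (2 : ℝ) ≤ d := by exact_mod_cast hd
  have hi : 1 / (d : ℝ) ≤ 1 / 2 := by gcongr
  have hi0 : 0 < 1 / (d : ℝ) := by positivity
  set α : ℝ := 1 - 1 / (d : ℝ) with hα
  have hα0 : 0 < α := by linarith
  induction n using Nat.strong_induction_on with
  | _ n ih =>
  intro Y w hY
  rcases lt_or_ge n 2 with hn | hn
  · have hexp : (1 : ℝ) ≤ Real.exp (16 * d / α * (n : ℝ) ^ α) := by
      apply Real.one_le_exp; positivity
    have key : ∀ M : Finset (Finset V), (∀ o, regionCrossCount M {x | R x o} = 0) →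
        ((∑ o, w o * 2 ^ regionCrossCount M {x | R x o} : ℕ) : ℝ) ≤
        ((∑ o, w o : ℕ) : ℝ) * Real.exp (16 * d / α * (n : ℝ) ^ α) := by
      intro M hM
      simp only [hM, pow_zero, mul_one]
      exact le_mul_of_one_le_right (Nat.cast_nonneg _) hexp
    rcases Nat.lt_or_ge n 1 with h1 | h1
    · have : Y = ∅ := Finset.card_eq_zero.1 (by omega)
      subst this
      exact ⟨∅, by simp [IsPerfectMatching], key _ (by simp [regionCrossCount])⟩
    · obtain ⟨x, rfl⟩ := Finset.card_eq_one.1 (show Y.card = 1 by omega)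
      refine ⟨{{x}}, ?_, key _ ?_⟩
      · refine ⟨by simp, by simp, by simp, ?_⟩
        exact (Finset.card_filter_le _ _).trans (by simp)
      · intro o
        simp only [regionCrossCount, Finset.card_eq_zero, Finset.filter_eq_empty_iff,
          Finset.mem_singleton]
        rintro e rfl ⟨⟨a, ha, haB⟩, b, hb, hbB⟩
        rw [Finset.mem_singleton] at ha hb
        subst ha; subst hb; exact hbB haB
  · obtain ⟨x, hx, y, hy, hxy, hsep⟩ := weighted_edge R Y d hd h (by omega) w
    let w' : H → ℕ := fun o => w o * if (R x o ↔ R y o) then 1 else 2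
    have hsub : ({x, y} : Finset V) ⊆ Y := by
      intro z; simp only [Finset.mem_insert, Finset.mem_singleton]; grind
    have hc2 : ({x, y} : Finset V).card = 2 := Finset.card_pair hxy
    obtain ⟨M, hM, hMw⟩ := ih (n - 2) (by omega) (Y \ {x, y}) w' (by
      rw [Finset.card_sdiff_of_subset hsub, hc2, hY])
    obtain ⟨m1, m2, m3, m4⟩ := hM
    have hdis : ∀ e ∈ M, Disjoint ({x, y} : Finset V) e := by
      intro e he
      have : e ⊆ Y \ {x, y} := by
        rw [← m3]; exact Finset.subset_biUnion_of_mem id he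
      exact (Finset.disjoint_of_subset_left this Finset.sdiff_disjoint).symm
    have hnot : ({x, y} : Finset V) ∉ M := by
      intro hh
      have := hdis _ hh
      rw [Finset.disjoint_self_iff_empty] at this
      rw [this] at hc2; simp at hc2
    refine ⟨insert {x, y} M, ⟨?_, ?_, ?_, ?_⟩, ?_⟩
    · intro e he
      rcases Finset.mem_insert.1 he with rfl | he
      · exact Or.inl hc2
      · exact m1 e he
    · rw [Finset.coe_insert]
      exact m2.insert fun e he _ => hdis e he
    · rw [Finset.biUnion_insert, m3, id, Finset.union_sdiff_of_subset hsub]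
    · rw [Finset.filter_insert, if_neg (by omega)]
      exact m4
    · have e1 : ∑ o, w o * 2 ^ regionCrossCount (insert {x, y} M) {x | R x o} =
          ∑ o, w' o * 2 ^ regionCrossCount M {x | R x o} := by
        refine Finset.sum_congr rfl fun o _ => ?_
        rw [cross_insert M x y _ hnot, pow_add]
        simp only [w', Set.mem_ofPred_eq]
        by_cases hh : (R x o ↔ R y o) <;> simp [hh]; ring
      have e2 : ∑ o, w' o = ∑ o, w o + ∑ o, if (R x o ↔ R y o) then 0 else w o := by
        rw [← Finset.sum_add_distrib]
        refine Finset.sum_congr rfl fun o _ => ?_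
        simp only [w']
        by_cases hh : (R x o ↔ R y o) <;> simp [hh]; ring
      rw [e1]
      refine hMw.trans ?_
      rw [hY] at hsep
      set W : ℝ := ((∑ o, w o : ℕ) : ℝ) with hW
      have hW0 : 0 ≤ W := Nat.cast_nonneg _
      have hn' : (2 : ℝ) ≤ n := by exact_mod_cast hn
      have hnp : (0 : ℝ) < n := by linarith
      set t : ℝ := 32 * d / (n : ℝ) ^ (1 / (d : ℝ)) with ht
      have e3 : ((∑ o, w' o : ℕ) : ℝ) ≤ W * Real.exp t := by
        rw [e2, Nat.cast_add]
        calc _ ≤ W + t * W := by gcongr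
          _ = W * (t + 1) := by ring
          _ ≤ _ := by gcongr; exact Real.add_one_le_exp t
      rw [Nat.cast_sub hn]
      rw [Nat.cast_two]
      calc _ ≤ W * Real.exp t * Real.exp (16 * d / α * ((n : ℝ) - 2) ^ α) := by gcongr
        _ = W * Real.exp (t + 16 * d / α * ((n : ℝ) - 2) ^ α) := by rw [mul_assoc, Real.exp_add]
        _ ≤ _ := by
          gcongr
          have hst := rpow_step α n hα0.le (by linarith) hn'
          have e4 : t = 16 * d / α * (2 * α * (n : ℝ) ^ (α - 1)) := by
            have : α - 1 = -(1 / (d : ℝ)) := by rw [hα]; ring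
            rw [this, Real.rpow_neg hnp.le, ht]
            field_simp; ring
          rw [e4, ← mul_add]
          have : 0 ≤ 16 * d / α := by positivity
          gcongr
          linarith

/-! ### Half-spaces -/

def hs {d : ℕ} (x : EuclideanSpace ℝ (Fin d)) (h : EuclideanSpace ℝ (Fin d) × ℝ) : Prop :=
  ⟪h.1, x⟫ ≤ h.2

lemma hs_dual {d : ℕ} {H : Type*} (φ : H → EuclideanSpace ℝ (Fin d) × ℝ) :
    DualVC (fun x o => hs x (φ o)) d := by
  intro g
  have hli : ¬ LinearIndependent ℝ (fun i : Fin (d + 1) => (φ (g i)).1) := by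
    intro hl
    have := hl.fintype_card_le_finrank
    simp at this
  rw [Fintype.not_linearIndependent_iff] at hli
  obtain ⟨l, hl, i0, hi0⟩ := hli
  have hz : ∀ x : EuclideanSpace ℝ (Fin d), ∑ i, l i * ⟪(φ (g i)).1, x⟫ = 0 := by
    intro x
    have : ⟪∑ i, l i • (φ (g i)).1, x⟫ = 0 := by rw [hl, inner_zero_left]
    rw [sum_inner] at this
    simpa [real_inner_smul_left] using this
  by_contra hcon
  push Not at hcon
  obtain ⟨x, hx⟩ := hcon (univ.filter fun i => 0 < l i)
  obtain ⟨y, hy⟩ := hcon (univ.filter fun i => l i < 0)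
  simp only [Finset.mem_filter, Finset.mem_univ, true_and, hs] at hx hy
  have h1 : ∀ i, l i * ⟪(φ (g i)).1, x⟫ ≤ l i * (φ (g i)).2 := by
    intro i
    have := hx i
    rcases lt_trichotomy (l i) 0 with h | h | h
    · have : ¬ ⟪(φ (g i)).1, x⟫ ≤ (φ (g i)).2 := fun hh => absurd (this.2 hh) (by linarith)
      nlinarith
    · simp [h]
    · have := this.1 h
      gcongr
  have h2 : ∀ i, l i * (φ (g i)).2 ≤ l i * ⟪(φ (g i)).1, y⟫ := by
    intro i
    have := hy i
    rcases lt_trichotomy (l i) 0 with h | h | h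
    · have := this.1 h
      nlinarith
    · simp [h]
    · have : ¬ ⟪(φ (g i)).1, y⟫ ≤ (φ (g i)).2 := fun hh => absurd (this.2 hh) (by linarith)
      nlinarith
  have h3 : l i0 * ⟪(φ (g i0)).1, x⟫ < l i0 * ⟪(φ (g i0)).1, y⟫ := by
    rcases lt_or_gt_of_ne hi0 with h | h
    · have hh : ¬ ⟪(φ (g i0)).1, x⟫ ≤ (φ (g i0)).2 :=
        fun hh => absurd ((hx i0).2 hh) (by linarith)
      have := h2 i0
      nlinarith
    · have hh : ¬ ⟪(φ (g i0)).1, y⟫ ≤ (φ (g i0)).2 :=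
        fun hh => absurd ((hy i0).2 hh) (by linarith)
      have := h1 i0
      nlinarith
  have h4 : ∑ i, l i * ⟪(φ (g i)).1, x⟫ < ∑ i, l i * ⟪(φ (g i)).1, y⟫ :=
    Finset.sum_lt_sum (fun i _ => (h1 i).trans (h2 i)) ⟨i0, Finset.mem_univ _, h3⟩
  rw [hz, hz] at h4
  exact lt_irrefl _ h4

noncomputable def ranges {d : ℕ} (X : Finset (EuclideanSpace ℝ (Fin d))) : Finset (Finset X) :=
  univ.filter fun S => ∃ h : EuclideanSpace ℝ (Fin d) × ℝ, ∀ x : X, x ∈ S ↔ hs x.1 h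

lemma ranges_card {d : ℕ} (X : Finset (EuclideanSpace ℝ (Fin d))) :
    (ranges X).card ≤ (X.card + 1) ^ (d + 1) := by
  have := sauer_s16 (ranges X) (d + 1) (by
    intro T hT
    by_contra hc
    have hcard : (T.map (Function.Embedding.subtype _)).card = T.card := Finset.card_map _
    obtain ⟨f, hf1, hf2, x0, hx0, hx0'⟩ :=
      Module.exists_nontrivial_relation_sum_zero_of_finrank_succ_lt_card (R := ℝ)
      (t := T.map (Function.Embedding.subtype _)) (by
        rw [hcard]; simp; omega)
    rw [Finset.sum_map] at hf1 hf2
    simp only [Function.Embedding.coe_subtype] at hf1 hf2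
    obtain ⟨z, hz, rfl⟩ := Finset.mem_map.1 hx0
    simp only [Function.Embedding.coe_subtype] at hx0'
    obtain ⟨u, hu, hun⟩ : ∃ u ∈ T, f u.1 < 0 := by
      by_contra hcon
      push Not at hcon
      exact hx0' ((Finset.sum_eq_zero_iff_of_nonneg hcon).1 hf2 z hz)
    obtain ⟨S, hS, hTS⟩ := hT (t := T.filter fun x => 0 < f x.1) (Finset.filter_subset _ _)
    obtain ⟨h, hh⟩ := (Finset.mem_filter.1 hS).2
    have hk : ∀ x ∈ T, (0 < f x.1 ↔ ⟪h.1, x.1⟫ ≤ h.2) := by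
      intro x hx
      have := Finset.ext_iff.1 hTS x
      simp only [Finset.mem_inter, Finset.mem_filter, hx, true_and] at this
      rw [← this, hh x, hs]
    have s1 : ∑ x ∈ T, f x.1 * ⟪h.1, x.1⟫ = 0 := by
      have : ⟪h.1, ∑ x ∈ T, f x.1 • x.1⟫ = 0 := by rw [hf1, inner_zero_right]
      rw [inner_sum] at this
      simpa [real_inner_smul_right] using this
    have s2 : ∑ x ∈ T, f x.1 * h.2 = 0 := by rw [← Finset.sum_mul, hf2, zero_mul]
    have s3 : ∑ x ∈ T, f x.1 * ⟪h.1, x.1⟫ < ∑ x ∈ T, f x.1 * h.2 := by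
      refine Finset.sum_lt_sum ?_ ⟨u, hu, ?_⟩
      · intro x hx
        have := hk x hx
        rcases lt_trichotomy (f x.1) 0 with h' | h' | h'
        · have : ¬ ⟪h.1, x.1⟫ ≤ h.2 := fun q => absurd (this.2 q) (by linarith)
          nlinarith
        · simp [h']
        · have := this.1 h'
          gcongr
      · have : ¬ ⟪h.1, u.1⟫ ≤ h.2 := fun q => absurd ((hk u hu).2 q) (by linarith)
        nlinarith
    rw [s1, s2] at s3
    exact lt_irrefl _ s3)
  simpa using this

lemma cross_congr {V : Type*} [DecidableEq V] (X : Finset V) (M : Finset (Finset V))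
    (hM : IsPerfectMatching X M) (B B' : Set V) (h : ∀ x ∈ X, x ∈ B ↔ x ∈ B') :
    regionCrossCount M B = regionCrossCount M B' := by
  unfold regionCrossCount
  congr 1
  refine Finset.filter_congr fun e he => ?_
  have hs : e ⊆ X := by
    rw [← hM.2.2.1]; exact Finset.subset_biUnion_of_mem id he
  have h' : ∀ x ∈ e, x ∈ B ↔ x ∈ B' := fun x hx => h x (hs hx)
  grind

/-- existence form of Corollary 4.2. For every `d ≥ 2` there is a constant `C(d)`
such that every `n`-point set in `ℝ^d` (`n ≥ 2`) has a perfect matching whose crossing number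
with respect to every half-space `{z : ⟪a,z⟫ ≤ b}` is at most
`(6d² + 12e(d+1)/((1−1/d)²·ln 2))·n^{1−1/d} + C·ln(dn)·ln n`. -/
theorem stmt_16 (d : ℕ) (hd : 2 ≤ d) :
    ∃ C : ℝ, ∀ X : Finset (EuclideanSpace ℝ (Fin d)), 2 ≤ X.card →
      ∃ M : Finset (Finset (EuclideanSpace ℝ (Fin d))), IsPerfectMatching X M ∧
        ∀ (a : EuclideanSpace ℝ (Fin d)) (b : ℝ),
          (regionCrossCount M {z : EuclideanSpace ℝ (Fin d) | ⟪a, z⟫ ≤ b} : ℝ) ≤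
            (6 * (d : ℝ) ^ 2 +
                12 * Real.exp 1 * ((d : ℝ) + 1) / ((1 - 1 / (d : ℝ)) ^ 2 * Real.log 2))
              * (X.card : ℝ) ^ (1 - 1 / (d : ℝ))
            + C * Real.log ((d : ℝ) * X.card) * Real.log X.card := by
  have hd' : (2 : ℝ) ≤ d := by exact_mod_cast hd
  have hi : 1 / (d : ℝ) ≤ 1 / 2 := by gcongr
  have hi0 : 0 < 1 / (d : ℝ) := by positivity
  have hl2 : 0 < Real.log 2 := Real.log_pos (by norm_num)
  refine ⟨2 * (d + 1) / Real.log 2, fun X hX => ?_⟩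
  have hr : ∀ S : ranges X, ∃ h : EuclideanSpace ℝ (Fin d) × ℝ, ∀ x : X, x ∈ S.1 ↔ hs x.1 h :=
    fun S => (Finset.mem_filter.1 S.2).2
  choose φ hφ using hr
  obtain ⟨M, hM, hW⟩ := mwu (fun x o => hs x (φ o)) d hd (hs_dual φ) X.card X (fun _ => 1) rfl
  refine ⟨M, hM, fun a b => ?_⟩
  let S : ranges X := ⟨univ.filter fun x : X => hs x.1 (a, b), by
    refine Finset.mem_filter.2 ⟨Finset.mem_univ _, (a, b), fun x => ?_⟩
    simp⟩
  have hS : ∀ x ∈ X, x ∈ {z : EuclideanSpace ℝ (Fin d) | ⟪a, z⟫ ≤ b} ↔ x ∈ {x | hs x (φ S)} := by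
    intro x hx
    have := hφ S ⟨x, hx⟩
    simp only [S, Finset.mem_filter, Finset.mem_univ, true_and] at this
    exact this
  rw [cross_congr X M hM _ _ hS]
  set k := regionCrossCount M {x | hs x (φ S)} with hk
  set α : ℝ := 1 - 1 / (d : ℝ) with hα
  have hα0 : 0 < α := by linarith
  have hα1 : α ≤ 1 := by linarith
  have hn : (2 : ℝ) ≤ X.card := by exact_mod_cast hX
  set n : ℝ := (X.card : ℝ) with hn'
  have h1 : (2 : ℝ) ^ k ≤ (n + 1) ^ (d + 1) * Real.exp (16 * d / α * n ^ α) := by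
    have a1 : 2 ^ k ≤ ∑ o, 1 * 2 ^ regionCrossCount M {x | hs x (φ o)} := by
      have := Finset.single_le_sum (f := fun o => 1 * 2 ^ regionCrossCount M {x | hs x (φ o)})
        (fun _ _ => Nat.zero_le _) (Finset.mem_univ S)
      simpa [hk] using this
    have a2 : ((∑ _o : ranges X, 1 : ℕ) : ℝ) ≤ (n + 1) ^ (d + 1) := by
      have := ranges_card X
      simp only [Finset.sum_const, card_univ, Fintype.card_coe, smul_eq_mul, mul_one, hn']
      exact_mod_cast this
    calc (2 : ℝ) ^ k = ((2 ^ k : ℕ) : ℝ) := by push_cast; rfl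
      _ ≤ _ := Nat.cast_le.2 a1
      _ ≤ _ := hW
      _ ≤ _ := by gcongr
  have h2 : k * Real.log 2 ≤ (d + 1) * Real.log (n + 1) + 16 * d / α * n ^ α := by
    have := Real.log_le_log (by positivity) h1
    rw [Real.log_pow, Real.log_mul (by positivity) (by positivity), Real.log_pow,
      Real.log_exp] at this
    push_cast at this
    exact this
  have hln : 0 < Real.log n := Real.log_pos (by linarith)
  have h3 : Real.log (n + 1) ≤ 2 * Real.log n := by
    have : 2 * Real.log n = Real.log (n ^ 2) := by rw [Real.log_pow]; norm_num
    rw [this]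
    exact Real.log_le_log (by linarith) (by nlinarith)
  have h4 : 1 ≤ Real.log (d * n) := by
    rw [Real.le_log_iff_exp_le (by positivity)]
    have := Real.exp_one_lt_d9
    nlinarith
  have h5 : (k : ℝ) ≤ 16 * d / (α * Real.log 2) * n ^ α + 2 * (d + 1) / Real.log 2 * Real.log n := by
    have e : 16 * d / (α * Real.log 2) * n ^ α + 2 * (d + 1) / Real.log 2 * Real.log n =
        ((d + 1) * (2 * Real.log n) + 16 * d / α * n ^ α) / Real.log 2 := by
      field_simp; ring
    rw [e, le_div_iff₀ hl2]
    have : ((d : ℝ) + 1) * Real.log (n + 1) ≤ (d + 1) * (2 * Real.log n) := by gcongr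
    linarith
  have h6 : 16 * d / (α * Real.log 2) ≤
      6 * (d : ℝ) ^ 2 + 12 * Real.exp 1 * ((d : ℝ) + 1) / (α ^ 2 * Real.log 2) := by
    have he : (2 : ℝ) ≤ Real.exp 1 := by
      have := Real.add_one_le_exp (1 : ℝ); linarith
    have hα2 : α ^ 2 ≤ α := by nlinarith
    have : 16 * d / (α * Real.log 2) ≤
        12 * Real.exp 1 * ((d : ℝ) + 1) / (α ^ 2 * Real.log 2) := by
      gcongr
      · nlinarith
      · linarith
    nlinarith [sq_nonneg (d : ℝ)]
  have h7 : 2 * ((d : ℝ) + 1) / Real.log 2 * Real.log n ≤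
      2 * (d + 1) / Real.log 2 * Real.log (d * n) * Real.log n := by
    have : 2 * ((d : ℝ) + 1) / Real.log 2 ≤ 2 * (d + 1) / Real.log 2 * Real.log (d * n) :=
      le_mul_of_one_le_right (by positivity) h4
    gcongr
  have h8 : 16 * d / (α * Real.log 2) * n ^ α ≤
      (6 * (d : ℝ) ^ 2 + 12 * Real.exp 1 * ((d : ℝ) + 1) / (α ^ 2 * Real.log 2)) * n ^ α := by
    gcongr
  linarith
end
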